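/- Let m, n, q be integers with m ≤ q ≤ n (q not necessarily a prime power). Consider an m-layered cake and n agents with additive valuations whose induced preferences are closed (i.e., each v_i is additive and continuous with respect to the symmetric-difference pseudo-metric on layered pieces). Then there exist a feasible and contiguous multi-division A = (A_1,…,A_q) of the m-layered cake into q layered pieces and a surjective assignment π : [n] → [q] such that: for every agent i ∈ [n], v_i(A_{π(i)}) ≥ (1/q)·v_i(C), where C is the entire layered cake (each agent receives at least her proportional fair share); and for every j ∈ [q], |π⁻¹(j)| ∈ {⌊n/q⌋, ⌈n/q⌉}. -/

import Mathlib

open MeasureTheory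

/-- A piece of cake: a finite union of closed subintervals of `[0,1]`. -/
def IsPiece (S : Set ℝ) : Prop :=
  ∃ I : Finset (ℝ × ℝ), (∀ p ∈ I, 0 ≤ p.1 ∧ p.2 ≤ 1) ∧ S = ⋃ p ∈ I, Set.Icc p.1 p.2

/-- A layered piece of the `m`-layered cake: one piece per layer. -/
def IsLayeredPiece {m : ℕ} (L : Fin m → Set ℝ) : Prop := ∀ ℓ, IsPiece (L ℓ)

/-- A contiguous layered piece: each component is a single (possibly empty or degenerate)
closed interval. -/
def IsContiguous {m : ℕ} (L : Fin m → Set ℝ) : Prop := ∀ ℓ, ∃ a b : ℝ, L ℓ = Set.Icc a b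

/-- A non-overlapping layered piece: pieces from different layers intersect in a finite set. -/
def IsNonOverlapping {m : ℕ} (L : Fin m → Set ℝ) : Prop :=
  ∀ ℓ ℓ', ℓ ≠ ℓ' → (L ℓ ∩ L ℓ').Finite

/-- A multi-division of the `m`-layered cake into `q` layered pieces: the pieces cover each
layer and have pairwise disjoint interiors (within each layer). -/
def IsMultiDivision {m q : ℕ} (A : Fin q → Fin m → Set ℝ) : Prop :=
  (∀ j, IsLayeredPiece (A j)) ∧
  (∀ ℓ, (⋃ j, A j ℓ) = Set.Icc (0 : ℝ) 1) ∧
  (∀ j j', j ≠ j' → ∀ ℓ, interior (A j ℓ) ∩ interior (A j' ℓ) = ∅)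

/-- The symmetric-difference pseudo-metric on layered pieces. -/
noncomputable def layeredDist {m : ℕ} (L L' : Fin m → Set ℝ) : ℝ :=
  ∑ ℓ, (volume (symmDiff (L ℓ) (L' ℓ))).toReal

/-- An additive valuation on layered pieces: the value of the union of two layered pieces with
(layerwise) disjoint interiors is the sum of their values. -/
def IsAdditive {m : ℕ} (v : (Fin m → Set ℝ) → ℝ) : Prop :=
  ∀ L L' : Fin m → Set ℝ, IsLayeredPiece L → IsLayeredPiece L' →
    (∀ ℓ, interior (L ℓ) ∩ interior (L' ℓ) = ∅) →
    v (fun ℓ => L ℓ ∪ L' ℓ) = v L + v L'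

/-! ### Affine chains and barycentric subdivision -/

section Chains

variable {E : Type*}

/-- Integral chains on `n`-tuples of points; tuples of length `0` give the augmentation. -/
abbrev TupleChain (E : Type*) (n : ℕ) : Type _ := (Fin n → E) →₀ ℤ

theorem tupleChain_hom_ext {n : ℕ} {M : Type*} [AddCommGroup M] {φ ψ : TupleChain E n →ₗ[ℤ] M}
    (h : ∀ σ, φ (Finsupp.single σ 1) = ψ (Finsupp.single σ 1)) : φ = ψ :=
  Finsupp.lhom_ext' fun σ => LinearMap.ext_ring (h σ)

/-- The simplicial boundary. -/
noncomputable def bd (n : ℕ) : TupleChain E (n + 1) →ₗ[ℤ] TupleChain E n :=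
  Finsupp.linearCombination ℤ fun σ =>
    ∑ i : Fin (n + 1), (-1 : ℤ) ^ (i : ℕ) • Finsupp.single (σ ∘ i.succAbove) 1

/-- The cone with apex `b`. -/
noncomputable def cone (b : E) (n : ℕ) : TupleChain E n →ₗ[ℤ] TupleChain E (n + 1) :=
  Finsupp.lmapDomain ℤ ℤ (fun σ : Fin n → E => (Fin.cons b σ : Fin (n + 1) → E))

theorem bd_single {n : ℕ} (σ : Fin (n + 1) → E) :
    bd n (Finsupp.single σ 1) =
      ∑ i : Fin (n + 1), (-1 : ℤ) ^ (i : ℕ) • Finsupp.single (σ ∘ i.succAbove) 1 := by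
  simp [bd]

theorem cone_single {n : ℕ} (b : E) (σ : Fin n → E) :
    cone b n (Finsupp.single σ 1) = Finsupp.single (Fin.cons b σ : Fin (n + 1) → E) 1 := by
  simp [cone]

theorem cons_comp_succ_succAbove {n : ℕ} (b : E) (σ : Fin (n + 1) → E) (j : Fin (n + 1)) :
    (Fin.cons b σ : Fin (n + 2) → E) ∘ j.succ.succAbove = Fin.cons b (σ ∘ j.succAbove) := by
  funext i
  refine Fin.cases ?_ (fun i => ?_) i <;> simp

theorem bd_cone {n : ℕ} (b : E) (c : TupleChain E (n + 1)) :
    bd (n + 1) (cone b (n + 1) c) = c - cone b n (bd n c) := by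
  have : bd (n + 1) ∘ₗ cone b (n + 1) = LinearMap.id - cone b n ∘ₗ bd n := by
    refine tupleChain_hom_ext fun σ => ?_
    simp only [LinearMap.comp_apply, LinearMap.sub_apply, LinearMap.id_apply, cone_single,
      bd_single, map_sum, map_smul]
    rw [Fin.sum_univ_succ]
    simp only [cons_comp_succ_succAbove, Fin.val_succ, pow_succ, Fin.val_zero, pow_zero, one_smul]
    rw [sub_eq_add_neg, ← Finset.sum_neg_distrib]
    congr 1
    exact Finset.sum_congr rfl fun j _ => by simp
  exact LinearMap.congr_fun this c

theorem bd_cone_zero (b : E) (c : TupleChain E 0) : bd 0 (cone b 0 c) = c := by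
  have : bd 0 ∘ₗ cone b 0 = LinearMap.id := by
    refine tupleChain_hom_ext fun σ => ?_
    simp only [LinearMap.comp_apply, LinearMap.id_apply, cone_single, bd_single]
    simp only [Fin.sum_univ_succ, Fin.val_zero, pow_zero, one_smul, Finset.univ_eq_empty,
      Finset.sum_empty, add_zero]
    congr 1
  exact LinearMap.congr_fun this c

theorem bd_bd : ∀ {n : ℕ} (c : TupleChain E (n + 2)), bd n (bd (n + 1) c) = 0 := by
  intro n
  induction n with
  | zero =>
    intro c
    have : (bd 0 ∘ₗ bd 1 : TupleChain E 2 →ₗ[ℤ] _) = 0 := by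
      refine tupleChain_hom_ext fun σ => ?_
      rw [← Fin.cons_self_tail σ, ← cone_single]
      simp [bd_cone, bd_cone_zero]
    exact LinearMap.congr_fun this c
  | succ n ih =>
    intro c
    have : (bd (n + 1) ∘ₗ bd (n + 2) : TupleChain E (n + 3) →ₗ[ℤ] _) = 0 := by
      refine tupleChain_hom_ext fun σ => ?_
      rw [← Fin.cons_self_tail σ, ← cone_single]
      simp [bd_cone, ih]
    exact LinearMap.congr_fun this c

theorem map_mem_supported {n m : ℕ} {φ : TupleChain E n →ₗ[ℤ] TupleChain E m}
    {S : Set (Fin n → E)} {S' : Set (Fin m → E)}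
    (h : ∀ σ ∈ S, φ (Finsupp.single σ 1) ∈ Finsupp.supported ℤ ℤ S') {c : TupleChain E n}
    (hc : c ∈ Finsupp.supported ℤ ℤ S) : φ c ∈ Finsupp.supported ℤ ℤ S' := by
  have : Finsupp.supported ℤ ℤ S ≤ (Finsupp.supported ℤ ℤ S').comap φ := by
    rw [Finsupp.supported_eq_span_single, Submodule.span_le]
    rintro _ ⟨σ, hσ, rfl⟩
    exact h σ hσ
  exact this hc

/-- Tuples of points of `C`. -/
def tuplesIn (C : Set E) (n : ℕ) : Set (Fin n → E) := {σ | ∀ i, σ i ∈ C}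

theorem cone_mem_supported {C : Set E} {b : E} (hb : b ∈ C) {n : ℕ} {c : TupleChain E n}
    (hc : c ∈ Finsupp.supported ℤ ℤ (tuplesIn C n)) :
    cone b n c ∈ Finsupp.supported ℤ ℤ (tuplesIn C (n + 1)) := by
  refine map_mem_supported (fun σ hσ => ?_) hc
  rw [cone_single]
  exact Finsupp.single_mem_supported _ _ fun i => Fin.cases hb hσ i

theorem bd_mem_supported {C : Set E} {n : ℕ} {c : TupleChain E (n + 1)}
    (hc : c ∈ Finsupp.supported ℤ ℤ (tuplesIn C (n + 1))) :
    bd n c ∈ Finsupp.supported ℤ ℤ (tuplesIn C n) := by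
  refine map_mem_supported (fun σ hσ => ?_) hc
  rw [bd_single]
  exact Submodule.sum_mem _ fun i _ => Submodule.smul_mem _ _
    (Finsupp.single_mem_supported _ _ fun j => hσ _)

variable [NormedAddCommGroup E] [NormedSpace ℝ E]

/-- The barycenter of a tuple of points. -/
noncomputable def barycenter {n : ℕ} (σ : Fin n → E) : E := (n : ℝ)⁻¹ • ∑ i, σ i

/-- The barycentric subdivision operator. -/
noncomputable def subdiv : (n : ℕ) → TupleChain E n →ₗ[ℤ] TupleChain E n
  | 0 => LinearMap.id
  | n + 1 => Finsupp.linearCombination ℤ fun σ =>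
      cone (barycenter σ) n (subdiv n (bd n (Finsupp.single σ 1)))

/-- The chain homotopy between the identity and the barycentric subdivision. -/
noncomputable def subdivHomotopy : (n : ℕ) → TupleChain E n →ₗ[ℤ] TupleChain E (n + 1)
  | 0 => 0
  | n + 1 => Finsupp.linearCombination ℤ fun σ =>
      cone (barycenter σ) (n + 1)
        (Finsupp.single σ 1 - subdivHomotopy n (bd n (Finsupp.single σ 1)))

theorem subdiv_single {n : ℕ} (σ : Fin (n + 1) → E) :
    subdiv (n + 1) (Finsupp.single σ 1) =
      cone (barycenter σ) n (subdiv n (bd n (Finsupp.single σ 1))) := by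
  simp [subdiv]

theorem subdivHomotopy_single {n : ℕ} (σ : Fin (n + 1) → E) :
    subdivHomotopy (n + 1) (Finsupp.single σ 1) = cone (barycenter σ) (n + 1)
        (Finsupp.single σ 1 - subdivHomotopy n (bd n (Finsupp.single σ 1))) := by
  simp [subdivHomotopy]

theorem bd_subdiv : ∀ {n : ℕ} (c : TupleChain E (n + 1)),
    bd n (subdiv (n + 1) c) = subdiv n (bd n c) := by
  intro n
  induction n with
  | zero =>
    intro c
    have : (bd 0 ∘ₗ subdiv 1 : TupleChain E 1 →ₗ[ℤ] _) = subdiv 0 ∘ₗ bd 0 := by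
      refine tupleChain_hom_ext fun σ => ?_
      simp only [LinearMap.comp_apply, subdiv_single, bd_cone_zero]
    exact LinearMap.congr_fun this c
  | succ n ih =>
    intro c
    have : (bd (n + 1) ∘ₗ subdiv (n + 2) : TupleChain E (n + 2) →ₗ[ℤ] _) =
        subdiv (n + 1) ∘ₗ bd (n + 1) := by
      refine tupleChain_hom_ext fun σ => ?_
      simp only [LinearMap.comp_apply, subdiv_single (n := n + 1), bd_cone, ih, bd_bd, map_zero,
        sub_zero]
    exact LinearMap.congr_fun this c

theorem bd_subdivHomotopy : ∀ {n : ℕ} (c : TupleChain E (n + 1)),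
    bd (n + 1) (subdivHomotopy (n + 1) c) = c - subdiv (n + 1) c - subdivHomotopy n (bd n c) := by
  intro n
  induction n with
  | zero =>
    intro c
    have : (bd 1 ∘ₗ subdivHomotopy 1 : TupleChain E 1 →ₗ[ℤ] _) =
        LinearMap.id - subdiv 1 - subdivHomotopy 0 ∘ₗ bd 0 := by
      refine tupleChain_hom_ext fun σ => ?_
      simp only [LinearMap.comp_apply, LinearMap.sub_apply, LinearMap.id_apply,
        subdivHomotopy_single, subdiv_single, bd_cone]
      simp [subdivHomotopy, subdiv]
    exact LinearMap.congr_fun this c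
  | succ n ih =>
    intro c
    have : (bd (n + 2) ∘ₗ subdivHomotopy (n + 2) : TupleChain E (n + 2) →ₗ[ℤ] _) =
        LinearMap.id - subdiv (n + 2) - subdivHomotopy (n + 1) ∘ₗ bd (n + 1) := by
      refine tupleChain_hom_ext fun σ => ?_
      simp only [LinearMap.comp_apply, LinearMap.sub_apply, LinearMap.id_apply,
        subdivHomotopy_single (n := n + 1), subdiv_single (n := n + 1), bd_cone, map_sub, ih,
        bd_bd, map_zero, sub_zero]
      abel
    exact LinearMap.congr_fun this c

theorem subdiv_pow_bd {n : ℕ} (N : ℕ) (c : TupleChain E (n + 1)) :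
    bd n ((subdiv (n + 1) ^ N) c) = (subdiv n ^ N) (bd n c) := by
  induction N generalizing c with
  | zero => rfl
  | succ N ih => rw [pow_succ, pow_succ, Module.End.mul_apply, Module.End.mul_apply, ih, bd_subdiv]

/-! #### Naturality -/

/-- Pushforward of chains along a linear map. -/
noncomputable def pushChain (L : E →ₗ[ℝ] E) (n : ℕ) : TupleChain E n →ₗ[ℤ] TupleChain E n :=
  Finsupp.lmapDomain ℤ ℤ (fun σ : Fin n → E => L ∘ σ)

theorem pushChain_single (L : E →ₗ[ℝ] E) {n : ℕ} (σ : Fin n → E) :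
    pushChain L n (Finsupp.single σ 1) = Finsupp.single (L ∘ σ) 1 := by
  simp [pushChain]

theorem barycenter_comp (L : E →ₗ[ℝ] E) {n : ℕ} (σ : Fin n → E) :
    barycenter (L ∘ σ) = L (barycenter σ) := by
  simp [barycenter]

theorem pushChain_cone (L : E →ₗ[ℝ] E) {n : ℕ} (b : E) (c : TupleChain E n) :
    pushChain L (n + 1) (cone b n c) = cone (L b) n (pushChain L n c) := by
  have : pushChain L (n + 1) ∘ₗ cone b n = cone (L b) n ∘ₗ pushChain L n := by
    refine tupleChain_hom_ext fun σ => ?_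
    simp only [LinearMap.comp_apply, cone_single, pushChain_single, Fin.comp_cons]
  exact LinearMap.congr_fun this c

theorem pushChain_bd (L : E →ₗ[ℝ] E) {n : ℕ} (c : TupleChain E (n + 1)) :
    pushChain L n (bd n c) = bd n (pushChain L (n + 1) c) := by
  have : pushChain L n ∘ₗ bd n = bd n ∘ₗ pushChain L (n + 1) := by
    refine tupleChain_hom_ext fun σ => ?_
    simp only [LinearMap.comp_apply, bd_single, map_sum, map_smul, pushChain_single,
      Function.comp_assoc]
  exact LinearMap.congr_fun this c

theorem pushChain_subdiv (L : E →ₗ[ℝ] E) : ∀ {n : ℕ} (c : TupleChain E n),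
    pushChain L n (subdiv n c) = subdiv n (pushChain L n c) := by
  intro n
  induction n with
  | zero => intro c; rfl
  | succ n ih =>
    intro c
    have : pushChain L (n + 1) ∘ₗ subdiv (n + 1) = subdiv (n + 1) ∘ₗ pushChain L (n + 1) := by
      refine tupleChain_hom_ext fun σ => ?_
      simp only [LinearMap.comp_apply, subdiv_single, pushChain_single, pushChain_cone, ih,
        pushChain_bd, barycenter_comp]
    exact LinearMap.congr_fun this c

theorem pushChain_subdiv_pow (L : E →ₗ[ℝ] E) {n : ℕ} (N : ℕ) (c : TupleChain E n) :
    pushChain L n ((subdiv n ^ N) c) = (subdiv n ^ N) (pushChain L n c) := by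
  induction N generalizing c with
  | zero => rfl
  | succ N ih => rw [pow_succ, Module.End.mul_apply, Module.End.mul_apply, ih, pushChain_subdiv]

theorem pushChain_subdivHomotopy (L : E →ₗ[ℝ] E) : ∀ {n : ℕ} (c : TupleChain E n),
    pushChain L (n + 1) (subdivHomotopy n c) = subdivHomotopy n (pushChain L n c) := by
  intro n
  induction n with
  | zero => intro c; simp [subdivHomotopy]
  | succ n ih =>
    intro c
    have : pushChain L (n + 2) ∘ₗ subdivHomotopy (n + 1) =
        subdivHomotopy (n + 1) ∘ₗ pushChain L (n + 1) := by
      refine tupleChain_hom_ext fun σ => ?_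
      simp only [LinearMap.comp_apply, subdivHomotopy_single, pushChain_single, pushChain_cone, ih,
        pushChain_bd, barycenter_comp, map_sub]
    exact LinearMap.congr_fun this c

/-! #### Supports -/

/-- Tuples of points of `C` at mutual distance at most `D`. -/
def smallTuples (C : Set E) (D : ℝ) (n : ℕ) : Set (Fin n → E) :=
  {σ | (∀ i, σ i ∈ C) ∧ ∀ i j, dist (σ i) (σ j) ≤ D}

theorem barycenter_mem {C : Set E} (hC : Convex ℝ C) {n : ℕ} {σ : Fin (n + 1) → E}
    (hσ : ∀ i, σ i ∈ C) : barycenter σ ∈ C := by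
  rw [barycenter, Finset.smul_sum]
  refine hC.sum_mem (fun _ _ => by positivity) ?_ fun i _ => hσ i
  simp
  field_simp

theorem subdiv_mem_supported {C : Set E} (hC : Convex ℝ C) : ∀ {n : ℕ} {c : TupleChain E n},
    c ∈ Finsupp.supported ℤ ℤ (tuplesIn C n) →
    subdiv n c ∈ Finsupp.supported ℤ ℤ (tuplesIn C n) := by
  intro n
  induction n with
  | zero => exact fun hc => hc
  | succ n ih =>
    refine fun hc => map_mem_supported (fun σ hσ => ?_) hc
    rw [subdiv_single]
    exact cone_mem_supported (barycenter_mem hC hσ)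
      (ih (bd_mem_supported (Finsupp.single_mem_supported _ _ hσ)))

theorem subdiv_pow_mem_supported {C : Set E} (hC : Convex ℝ C) {n : ℕ} (N : ℕ)
    {c : TupleChain E n} (hc : c ∈ Finsupp.supported ℤ ℤ (tuplesIn C n)) :
    (subdiv n ^ N) c ∈ Finsupp.supported ℤ ℤ (tuplesIn C n) := by
  induction N generalizing c with
  | zero => exact hc
  | succ N ih => rw [pow_succ]; exact ih (subdiv_mem_supported hC hc)

theorem subdivHomotopy_mem_supported {C : Set E} (hC : Convex ℝ C) :
    ∀ {n : ℕ} {c : TupleChain E n}, c ∈ Finsupp.supported ℤ ℤ (tuplesIn C n) →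
    subdivHomotopy n c ∈ Finsupp.supported ℤ ℤ (tuplesIn C (n + 1)) := by
  intro n
  induction n with
  | zero => exact fun _ => Submodule.zero_mem _
  | succ n ih =>
    refine fun hc => map_mem_supported (fun σ hσ => ?_) hc
    rw [subdivHomotopy_single]
    have hs : Finsupp.single σ (1 : ℤ) ∈ Finsupp.supported ℤ ℤ (tuplesIn C (n + 1)) :=
      Finsupp.single_mem_supported _ _ hσ
    exact cone_mem_supported (barycenter_mem hC hσ)
      (Submodule.sub_mem _ hs (ih (bd_mem_supported hs)))

theorem dist_barycenter_le {n : ℕ} {σ : Fin (n + 1) → E} {D r : ℝ}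
    (hr : (n + 1 : ℝ) * (1 - r) ≤ 1) (hD : ∀ i j, dist (σ i) (σ j) ≤ D) (i : Fin (n + 1)) :
    dist (σ i) (barycenter σ) ≤ r * D := by
  have hD0 : 0 ≤ D := dist_nonneg.trans (hD i i)
  have h1 : σ i - barycenter σ = ((n + 1 : ℕ) : ℝ)⁻¹ • ∑ j, (σ i - σ j) := by
    rw [Finset.sum_sub_distrib, smul_sub, barycenter]
    congr 1
    simp only [Finset.sum_const, Finset.card_univ, Fintype.card_fin]
    rw [← Nat.cast_smul_eq_nsmul ℝ, smul_smul, inv_mul_cancel₀ (by positivity), one_smul]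
  have h2 : ‖∑ j, (σ i - σ j)‖ ≤ n * D := by
    rw [Fin.sum_univ_succAbove _ i, sub_self, zero_add]
    refine (norm_sum_le _ _).trans ?_
    refine (Finset.sum_le_sum fun j _ => (dist_eq_norm (σ i) _).symm.le.trans (hD i _)).trans ?_
    simp
  rw [dist_eq_norm, h1, norm_smul, norm_inv, Real.norm_natCast]
  rw [inv_mul_le_iff₀ (by positivity)]
  push_cast
  nlinarith

theorem subdiv_single_mem_smallTuples {r D : ℝ} (hr1 : r ≤ 1) : ∀ {n : ℕ},
    (n : ℝ) * (1 - r) ≤ 1 → ∀ {σ : Fin n → E}, (∀ i j, dist (σ i) (σ j) ≤ D) →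
    subdiv n (Finsupp.single σ 1) ∈
      Finsupp.supported ℤ ℤ (smallTuples (convexHull ℝ (Set.range σ)) (r * D) n) := by
  intro n
  induction n with
  | zero =>
    intro _ σ _
    exact Finsupp.single_mem_supported _ _ ⟨fun i => i.elim0, fun i => i.elim0⟩
  | succ n ih =>
    intro hr σ hσ
    push_cast at hr
    have hball : convexHull ℝ (Set.range σ) ⊆ Metric.closedBall (barycenter σ) (r * D) :=
      convexHull_min (by rintro _ ⟨i, rfl⟩; exact dist_barycenter_le hr hσ i)
        (convex_closedBall _ _)
    have hb : barycenter σ ∈ convexHull ℝ (Set.range σ) :=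
      barycenter_mem (convex_convexHull ℝ _) fun i => subset_convexHull ℝ _ ⟨i, rfl⟩
    have h0 : 0 ≤ r * D := dist_nonneg.trans (hball hb)
    rw [subdiv_single]
    refine map_mem_supported
      (S := smallTuples (convexHull ℝ (Set.range σ)) (r * D) n) (fun τ hτ => ?_) ?_
    · rw [cone_single]
      refine Finsupp.single_mem_supported _ _ ⟨fun i => Fin.cases hb hτ.1 i, fun i j => ?_⟩
      refine Fin.cases (Fin.cases ?_ (fun j => ?_) j) (fun i => Fin.cases ?_ (fun j => ?_) j) i
      · simpa using h0
      · simpa [dist_comm] using hball (hτ.1 j)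
      · simpa using hball (hτ.1 i)
      · simpa using hτ.2 i j
    · rw [bd_single, map_sum]
      refine Submodule.sum_mem _ fun i _ => ?_
      rw [map_smul]
      refine Submodule.smul_mem _ _ (Finsupp.supported_mono ?_ (ih (by linarith)
        (σ := σ ∘ i.succAbove) fun a b => hσ _ _))
      exact fun τ hτ => ⟨fun a => convexHull_mono (Set.range_comp_subset_range _ _) (hτ.1 a), hτ.2⟩

theorem subdiv_pow_mem_smallTuples {C : Set E} (hC : Convex ℝ C) {r D : ℝ} (hr1 : r ≤ 1) {n : ℕ}
    (hr : (n : ℝ) * (1 - r) ≤ 1) (N : ℕ) {c : TupleChain E n}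
    (hc : c ∈ Finsupp.supported ℤ ℤ (smallTuples C D n)) :
    (subdiv n ^ N) c ∈ Finsupp.supported ℤ ℤ (smallTuples C (r ^ N * D) n) := by
  induction N generalizing c D with
  | zero => simpa using hc
  | succ N ih =>
    rw [pow_succ, pow_succ, mul_assoc]
    refine ih (map_mem_supported (fun σ hσ => ?_) hc)
    refine Finsupp.supported_mono ?_ (subdiv_single_mem_smallTuples hr1 hr hσ.2)
    exact fun τ hτ => ⟨fun a => convexHull_min (by rintro _ ⟨i, rfl⟩; exact hσ.1 i) hC (hτ.1 a),
      hτ.2⟩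

end Chains

/-! ### Rainbow simplices for equivariant labellings -/

section Rainbow

variable {k : ℕ}

/-- The sign of a self-map of `Fin (k + 1)`, zero if it is not bijective. -/
def labelSign (a : Fin (k + 1) → Fin (k + 1)) : ℤ :=
  Matrix.det (Matrix.of fun i j => if a i = j then (1 : ℤ) else 0)

theorem injective_of_labelSign_ne_zero {a : Fin (k + 1) → Fin (k + 1)} (h : labelSign a ≠ 0) :
    Function.Injective a := by
  intro i j hij
  by_contra hne
  exact h (Matrix.det_zero_of_row_eq hne (by ext l; simp [hij]))

theorem labelSign_perm_comp (ρ : Equiv.Perm (Fin (k + 1))) (a : Fin (k + 1) → Fin (k + 1)) :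
    labelSign (ρ ∘ a) = Equiv.Perm.sign ρ * labelSign a := by
  have h := Matrix.det_permute' ρ.symm (Matrix.of fun i j => if a i = j then (1 : ℤ) else 0)
  rw [Int.cast_id, Equiv.Perm.sign_symm] at h
  rw [labelSign, labelSign, ← h]
  congr 1
  ext i j
  simp [Equiv.eq_symm_apply]

theorem labelSign_perm (ρ : Equiv.Perm (Fin (k + 1))) :
    labelSign ρ = Equiv.Perm.sign ρ := by
  have h := labelSign_perm_comp ρ id
  rw [Function.comp_id] at h
  rw [h]
  have : labelSign (id : Fin (k + 1) → Fin (k + 1)) = 1 := by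
    have h1 : Matrix.of (fun i j : Fin (k + 1) => if id i = j then (1 : ℤ) else 0) = 1 := by
      ext i j
      simp [Matrix.one_apply]
    rw [labelSign, h1, Matrix.det_one]
  rw [this, mul_one]

theorem sum_labelSign_faces (a : Fin (k + 2) → Fin (k + 1)) :
    ∑ i : Fin (k + 2), (-1 : ℤ) ^ (i : ℕ) * labelSign (a ∘ i.succAbove) = 0 := by
  let A : Matrix (Fin (k + 2)) (Fin (k + 2)) ℤ :=
    Matrix.of fun i => Fin.cons 1 fun j => if a i = j then (1 : ℤ) else 0
  have hA : A.det = 0 := by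
    refine Matrix.exists_mulVec_eq_zero_iff.1 ⟨Fin.cons (-1) fun _ => 1, ?_, ?_⟩
    · intro h
      simpa using congrFun h 0
    · ext i
      simp [A, Matrix.mulVec, dotProduct, Fin.sum_univ_succ (n := k + 1)]
  rw [← hA, Matrix.det_succ_column_zero]
  refine Finset.sum_congr rfl fun i _ => ?_
  have : A i 0 = 1 := by simp [A]
  rw [this, mul_one, labelSign]
  rfl

/-- The signed number of rainbow tuples in a chain. -/
noncomputable def rainbow {E : Type*} (l : E → Fin (k + 1)) : TupleChain E (k + 1) →ₗ[ℤ] ℤ :=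
  Finsupp.linearCombination ℤ fun τ => labelSign (l ∘ τ)

theorem rainbow_single {E : Type*} (l : E → Fin (k + 1)) (τ : Fin (k + 1) → E) :
    rainbow l (Finsupp.single τ 1) = labelSign (l ∘ τ) := by
  simp [rainbow]

theorem rainbow_bd {E : Type*} (l : E → Fin (k + 1)) (c : TupleChain E (k + 2)) :
    rainbow l (bd (k + 1) c) = 0 := by
  have : rainbow l ∘ₗ bd (k + 1) = 0 := by
    refine tupleChain_hom_ext fun σ => ?_
    simp only [LinearMap.comp_apply, bd_single, map_sum, map_smul, rainbow_single, smul_eq_mul,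
      LinearMap.zero_apply]
    exact sum_labelSign_faces (l ∘ σ)
  exact LinearMap.congr_fun this c

theorem rainbow_eq_sum {E : Type*} (l : E → Fin (k + 1)) (c : TupleChain E (k + 1)) :
    rainbow l c = ∑ τ ∈ c.support, c τ * labelSign (l ∘ τ) := by
  simp [rainbow, Finsupp.linearCombination_apply, Finsupp.sum]

theorem rainbow_eq_mul {E : Type*} {l l' : E → Fin (k + 1)} {C : Set E} {s : ℤ}
    (h : ∀ τ ∈ tuplesIn C (k + 1), labelSign (l ∘ τ) = s * labelSign (l' ∘ τ))
    {c : TupleChain E (k + 1)} (hc : c ∈ Finsupp.supported ℤ ℤ (tuplesIn C (k + 1))) :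
    rainbow l c = s * rainbow l' c := by
  rw [rainbow_eq_sum, rainbow_eq_sum, Finset.mul_sum]
  refine Finset.sum_congr rfl fun τ hτ => ?_
  rw [h τ (hc hτ)]
  ring

/-- The cyclic shift. -/
def shift (k : ℕ) : Equiv.Perm (Fin (k + 1)) := Equiv.addRight 1

theorem shift_apply (a : Fin (k + 1)) : shift k a = a + 1 := rfl

theorem eq_add_of_comm_shift {u : Fin (k + 1) → Fin (k + 1)}
    (hu : ∀ a, u (a + 1) = u a + 1) (a : Fin (k + 1)) : u a = a + u 0 := by
  induction a using Fin.induction with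
  | zero => simp
  | succ i ih =>
    rw [← Fin.coeSucc_eq_succ, hu, ih]
    abel

theorem card_dvd_sum_of_shift_invariant {h : Equiv.Perm (Fin (k + 1)) → ℤ}
    (hh : ∀ π, h (shift k * π) = h π) : ((k + 1 : ℕ) : ℤ) ∣ ∑ π, h π := by
  let H : Fin (k + 1) → ℤ := fun a => ∑ π : Equiv.Perm (Fin (k + 1)), if π 0 = a then h π else 0
  have hH : ∀ a, H (a + 1) = H a := by
    intro a
    refine (Fintype.sum_equiv (Equiv.mulLeft (shift k)) _ _ fun π => ?_).symm
    simp [hh, shift_apply]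
  have hconst : ∀ a, H a = H 0 := by
    intro a
    induction a using Fin.induction with
    | zero => rfl
    | succ i ih => rw [← Fin.coeSucc_eq_succ, hH, ih]
  refine ⟨H 0, ?_⟩
  have : ∑ π, h π = ∑ a, H a := by
    rw [Finset.sum_comm]
    simp
  rw [this]
  simp [hconst]

/-- The vertices of the standard simplex. -/
noncomputable def vertex (k : ℕ) (a : Fin (k + 1)) : Fin (k + 1) → ℝ := Pi.single a 1

/-- Permutation of coordinates by the cyclic shift. -/
noncomputable def shiftMap (k : ℕ) : (Fin (k + 1) → ℝ) →ₗ[ℝ] (Fin (k + 1) → ℝ) :=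
  LinearMap.funLeft ℝ ℝ (shift k).symm

theorem shiftMap_apply (x : Fin (k + 1) → ℝ) (a : Fin (k + 1)) :
    shiftMap k x a = x ((shift k).symm a) := rfl

theorem shiftMap_vertex (a : Fin (k + 1)) : shiftMap k (vertex k a) = vertex k (shift k a) := by
  ext b
  simp [shiftMap_apply, vertex, Pi.single_apply, Equiv.symm_apply_eq]

theorem vertex_mem (a : Fin (k + 1)) : vertex k a ∈ stdSimplex ℝ (Fin (k + 1)) :=
  single_mem_stdSimplex ℝ a

/-- The facet of the standard simplex opposite to `vertex k a`. -/
def facet (k : ℕ) (a : Fin (k + 1)) : Set (Fin (k + 1) → ℝ) :=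
  {x | x ∈ stdSimplex ℝ (Fin (k + 1)) ∧ x a = 0}

theorem convex_facet (a : Fin (k + 1)) : Convex ℝ (facet k a) := by
  refine (convex_stdSimplex ℝ _).inter fun x hx y hy s t _ _ _ => ?_
  have hx' : x a = 0 := hx
  have hy' : y a = 0 := hy
  change s * x a + t * y a = 0
  rw [hx', hy']
  ring

/-- A labelling of ordered cells: it depends only on the order of the letters of nonzero weight
and commutes with the cyclic shift. -/
structure IsEquivariantLabelling (Λ : Equiv.Perm (Fin (k + 1)) → (Fin (k + 1) → ℝ) → Fin (k + 1)) :
    Prop where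
  congr : ∀ π π' x, x ∈ stdSimplex ℝ (Fin (k + 1)) →
    (∀ s t, x s ≠ 0 → x t ≠ 0 → (π.symm s < π.symm t ↔ π'.symm s < π'.symm t)) → Λ π x = Λ π' x
  shift : ∀ π x, x ∈ stdSimplex ℝ (Fin (k + 1)) →
    Λ (shift k * π) (shiftMap k x) = shift k (Λ π x)

theorem cycleRange_lt_iff {i a b : Fin (k + 1)} (ha : a ≠ i) (hb : b ≠ i) :
    i.cycleRange a < i.cycleRange b ↔ a < b := by
  obtain ⟨a, rfl⟩ := Fin.exists_succAbove_eq ha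
  obtain ⟨b, rfl⟩ := Fin.exists_succAbove_eq hb
  cases k with
  | zero => exact a.elim0
  | succ k => simp [Fin.cycleRange_succAbove, Fin.succAbove_lt_succAbove_iff]

variable {Λ : Equiv.Perm (Fin (k + 1)) → (Fin (k + 1) → ℝ) → Fin (k + 1)}

/-- The homotopy chain of a face. -/
noncomputable def faceHomotopy (k N : ℕ) (τ : Fin k → Fin (k + 1)) :
    TupleChain (Fin (k + 1) → ℝ) (k + 1) :=
  subdivHomotopy k ((subdiv k ^ N) (Finsupp.single (vertex k ∘ τ) 1))

theorem faceHomotopy_mem {N : ℕ} {τ : Fin k → Fin (k + 1)} {C : Set (Fin (k + 1) → ℝ)}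
    (hC : Convex ℝ C) (h : ∀ i, vertex k (τ i) ∈ C) :
    faceHomotopy k N τ ∈ Finsupp.supported ℤ ℤ (tuplesIn C (k + 1)) :=
  subdivHomotopy_mem_supported hC (subdiv_pow_mem_supported hC N
    (Finsupp.single_mem_supported _ _ h))

theorem faceHomotopy_shift (N : ℕ) (τ : Fin k → Fin (k + 1)) :
    faceHomotopy k N (shift k ∘ τ) = pushChain (shiftMap k) (k + 1) (faceHomotopy k N τ) := by
  have h : vertex k ∘ (shift k ∘ τ) = shiftMap k ∘ (vertex k ∘ τ) := by
    funext i
    exact (shiftMap_vertex _).symm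
  rw [faceHomotopy, faceHomotopy, pushChain_subdivHomotopy, pushChain_subdiv_pow,
    pushChain_single, h]

theorem rainbow_pushChain (l : (Fin (k + 1) → ℝ) → Fin (k + 1))
    (c : TupleChain (Fin (k + 1) → ℝ) (k + 1)) :
    rainbow l (pushChain (shiftMap k) (k + 1) c) = rainbow (l ∘ shiftMap k) c := by
  have : rainbow l ∘ₗ pushChain (shiftMap k) (k + 1) = rainbow (l ∘ shiftMap k) := by
    refine tupleChain_hom_ext fun σ => ?_
    simp only [LinearMap.comp_apply, pushChain_single, rainbow_single, Function.comp_assoc]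
  exact LinearMap.congr_fun this c

/-- The contribution of the face omitting the first letter. -/
noncomputable def faceTerm (Λ : Equiv.Perm (Fin (k + 1)) → (Fin (k + 1) → ℝ) → Fin (k + 1))
    (N : ℕ) (π : Equiv.Perm (Fin (k + 1))) : ℤ :=
  Equiv.Perm.sign π * rainbow (Λ π) (faceHomotopy k N (π ∘ Fin.succ))

theorem faceTerm_shift (hΛ : IsEquivariantLabelling Λ) (N : ℕ) (π : Equiv.Perm (Fin (k + 1))) :
    faceTerm Λ N (shift k * π) = faceTerm Λ N π := by
  have h1 : (shift k * π) ∘ (Fin.succ : Fin k → _) = shift k ∘ (π ∘ Fin.succ) := rfl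
  have h2 : rainbow (Λ (shift k * π) ∘ shiftMap k) (faceHomotopy k N (π ∘ Fin.succ)) =
      Equiv.Perm.sign (shift k) * rainbow (Λ π) (faceHomotopy k N (π ∘ Fin.succ)) := by
    refine rainbow_eq_mul (C := stdSimplex ℝ _) (fun τ hτ => ?_)
      (faceHomotopy_mem (convex_stdSimplex ℝ _) fun i => vertex_mem _)
    rw [← labelSign_perm_comp]
    congr 1
    funext i
    exact hΛ.shift π _ (hτ i)
  rw [faceTerm, faceTerm, h1, faceHomotopy_shift, rainbow_pushChain, h2, Equiv.Perm.sign_mul]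
  push_cast
  have h3 : ((Equiv.Perm.sign (shift k) : ℤˣ) : ℤ) * (Equiv.Perm.sign (shift k) : ℤˣ) = 1 := by
    rw [← Units.val_mul, Int.units_mul_self, Units.val_one]
  linear_combination (Equiv.Perm.sign π : ℤ) *
    rainbow (Λ π) (faceHomotopy k N (π ∘ Fin.succ)) * h3

theorem faceTerm_mul_cycleRange (hΛ : IsEquivariantLabelling Λ) (N : ℕ)
    (π : Equiv.Perm (Fin (k + 1))) (i : Fin (k + 1)) :
    faceTerm Λ N (π * i.cycleRange.symm) = Equiv.Perm.sign π * ((-1) ^ (i : ℕ) *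
      rainbow (Λ π) (faceHomotopy k N (π ∘ i.succAbove))) := by
  have h1 : (π * i.cycleRange.symm) ∘ (Fin.succ : Fin k → _) = π ∘ i.succAbove := by
    funext j
    simp
  have h2 : rainbow (Λ (π * i.cycleRange.symm)) (faceHomotopy k N (π ∘ i.succAbove)) =
      1 * rainbow (Λ π) (faceHomotopy k N (π ∘ i.succAbove)) := by
    refine rainbow_eq_mul (C := facet k (π i)) (fun τ hτ => ?_)
      (faceHomotopy_mem (convex_facet _) fun j => ⟨vertex_mem _, ?_⟩)
    · rw [one_mul]
      congr 1
      funext j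
      refine hΛ.congr _ _ _ (hτ j).1 fun s t hs ht => ?_
      have hne : ∀ s, τ j s ≠ 0 → π.symm s ≠ i := by
        rintro s hs rfl
        exact hs (by simpa using (hτ j).2)
      exact cycleRange_lt_iff (hne s hs) (hne t ht)
    · simp [vertex, Fin.ne_succAbove]
  rw [faceTerm, h1, h2, one_mul, Equiv.Perm.sign_mul, Equiv.Perm.sign_symm, Fin.sign_cycleRange]
  push_cast
  ring

/-- The signed count of rainbow simplices over all ordered cells. -/
noncomputable def rainbowCount
    (Λ : Equiv.Perm (Fin (k + 1)) → (Fin (k + 1) → ℝ) → Fin (k + 1)) (N : ℕ) : ℤ :=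
  ∑ π : Equiv.Perm (Fin (k + 1)), Equiv.Perm.sign π *
    rainbow (Λ π) ((subdiv (k + 1) ^ N) (Finsupp.single (vertex k ∘ π) 1))

theorem rainbow_sub_subdiv (l : (Fin (k + 1) → ℝ) → Fin (k + 1)) (N : ℕ)
    (π : Equiv.Perm (Fin (k + 1))) :
    rainbow l ((subdiv (k + 1) ^ N) (Finsupp.single (vertex k ∘ π) 1)) -
      rainbow l ((subdiv (k + 1) ^ (N + 1)) (Finsupp.single (vertex k ∘ π) 1)) =
    ∑ i : Fin (k + 1), (-1) ^ (i : ℕ) * rainbow l (faceHomotopy k N (π ∘ i.succAbove)) := by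
  have h := congrArg (rainbow l) (bd_subdivHomotopy
    ((subdiv (k + 1) ^ N) (Finsupp.single (vertex k ∘ π) 1)))
  rw [rainbow_bd, map_sub, map_sub, subdiv_pow_bd, bd_single] at h
  rw [pow_succ', Module.End.mul_apply, sub_eq_zero.1 h.symm]
  simp only [map_sum, map_smul, smul_eq_mul]
  rfl

theorem sq_dvd_rainbowCount_sub (hΛ : IsEquivariantLabelling Λ) (N : ℕ) :
    ((k + 1 : ℕ) : ℤ) ^ 2 ∣ rainbowCount Λ N - rainbowCount Λ (N + 1) := by
  have h : rainbowCount Λ N - rainbowCount Λ (N + 1) =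
      ((k + 1 : ℕ) : ℤ) * ∑ π, faceTerm Λ N π := by
    rw [rainbowCount, rainbowCount, ← Finset.sum_sub_distrib]
    simp only [← mul_sub, rainbow_sub_subdiv, Finset.mul_sum, ← faceTerm_mul_cycleRange hΛ]
    rw [Finset.sum_comm]
    have : ∀ i : Fin (k + 1), ∑ π, faceTerm Λ N (π * i.cycleRange.symm) =
        ∑ π, faceTerm Λ N π := fun i =>
      Fintype.sum_equiv (Equiv.mulRight i.cycleRange.symm) _ _ fun π => rfl
    simp [this, ← Finset.mul_sum]
  rw [h, sq]
  exact mul_dvd_mul_left _ (card_dvd_sum_of_shift_invariant (faceTerm_shift hΛ N))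

theorem rainbowCount_zero (hΛ : IsEquivariantLabelling Λ) :
    ∃ u : ℤˣ, rainbowCount Λ 0 = (u : ℤ) * ((k + 1).factorial : ℤ) := by
  have hu : ∀ π a, Λ π (vertex k a) = Λ 1 (vertex k a) := by
    refine fun π a => hΛ.congr _ _ _ (vertex_mem a) fun s t hs ht => ?_
    have hz : ∀ s, vertex k a s ≠ 0 → s = a := by
      intro s hs
      by_contra hne
      exact hs (by simp [vertex, hne])
    rw [hz s hs, hz t ht]
    simp
  have hs : ∀ a, Λ 1 (vertex k (a + 1)) = Λ 1 (vertex k a) + 1 := by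
    intro a
    rw [← shift_apply, ← shift_apply, ← shiftMap_vertex, ← hΛ.shift 1 _ (vertex_mem a),
      shiftMap_vertex]
    exact (hu _ _).symm
  have hadd := eq_add_of_comm_shift (u := fun a => Λ 1 (vertex k a)) hs
  refine ⟨Equiv.Perm.sign (Equiv.addRight (Λ 1 (vertex k 0))), ?_⟩
  rw [rainbowCount]
  have : ∀ π : Equiv.Perm (Fin (k + 1)), (Equiv.Perm.sign π : ℤ) *
      rainbow (Λ π) ((subdiv (k + 1) ^ 0) (Finsupp.single (vertex k ∘ π) 1)) =
      Equiv.Perm.sign (Equiv.addRight (Λ 1 (vertex k 0))) := by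
    intro π
    rw [pow_zero, Module.End.one_apply, rainbow_single]
    have h1 : Λ π ∘ (vertex k ∘ π) = Equiv.addRight (Λ 1 (vertex k 0)) ∘ π := by
      funext i
      exact (hu π _).trans (hadd _)
    rw [h1, labelSign_perm_comp, labelSign_perm, mul_left_comm, ← Units.val_mul,
      Int.units_mul_self, Units.val_one, mul_one]
  simp only [this, Finset.sum_const, Finset.card_univ, Fintype.card_perm, Fintype.card_fin,
    nsmul_eq_mul]
  ring

theorem exists_small_rainbow (hp : (k + 1).Prime) (hΛ : IsEquivariantLabelling Λ) (N : ℕ) :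
    ∃ π, ∃ τ ∈ smallTuples (stdSimplex ℝ (Fin (k + 1))) ((1 - 1 / (k + 1 : ℝ)) ^ N) (k + 1),
      Function.Surjective (Λ π ∘ τ) := by
  have hcount : rainbowCount Λ N ≠ 0 := by
    intro h0
    have hdvd : ((k + 1 : ℕ) : ℤ) ^ 2 ∣ rainbowCount Λ 0 - rainbowCount Λ N := by
      clear h0
      induction N with
      | zero => simp
      | succ N ih => simpa using dvd_add ih (sq_dvd_rainbowCount_sub hΛ N)
    obtain ⟨u, hu⟩ := rainbowCount_zero hΛ
    rw [h0, sub_zero, hu, Units.dvd_mul_left] at hdvd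
    norm_cast at hdvd
    rw [Nat.factorial_succ, sq] at hdvd
    have := (hp.dvd_factorial).1 (Nat.dvd_of_mul_dvd_mul_left (Nat.succ_pos k) hdvd)
    omega
  obtain ⟨π, -, hπ⟩ := Finset.exists_ne_zero_of_sum_ne_zero hcount
  have hπ' := right_ne_zero_of_mul hπ
  rw [rainbow_eq_sum] at hπ'
  obtain ⟨τ, hτ, hτ0⟩ := Finset.exists_ne_zero_of_sum_ne_zero hπ'
  refine ⟨π, τ, ?_, Finite.surjective_of_injective
    (injective_of_labelSign_ne_zero (right_ne_zero_of_mul hτ0))⟩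
  have hmem : Finsupp.single (vertex k ∘ π) (1 : ℤ) ∈ Finsupp.supported ℤ ℤ
      (smallTuples (stdSimplex ℝ (Fin (k + 1))) 1 (k + 1)) := by
    refine Finsupp.single_mem_supported _ _ ⟨fun i => vertex_mem _, fun i j => ?_⟩
    refine (dist_pi_le_iff zero_le_one).2 fun b => ?_
    simp only [Function.comp_apply, vertex, Pi.single_apply]
    split_ifs <;> simp
  have hk : (0 : ℝ) < k + 1 := by positivity
  have := subdiv_pow_mem_smallTuples (convex_stdSimplex ℝ _) (r := 1 - 1 / (k + 1 : ℝ))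
    (by simp; positivity) (by push_cast; field_simp; simp) N hmem
  rw [mul_one] at this
  exact this hτ

end Rainbow

/-! ### Rounding fractional assignments -/

section Rounding

theorem exists_injective_of_fractional_matching {R C : Type*} [Fintype R] [Fintype C]
    {M : R → C → ℝ} (h0 : ∀ r c, 0 ≤ M r c) (hrow : ∀ r, ∑ c, M r c = 1)
    (hcol : ∀ c, ∑ r, M r c ≤ 1) :
    ∃ f : R → C, Function.Injective f ∧ ∀ r, 0 < M r (f r) := by
  classical
  suffices H : ∀ s : Finset R,
      s.card ≤ (s.biUnion fun r => Finset.univ.filter fun c => 0 < M r c).card by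
    obtain ⟨f, hf, hfm⟩ := (Finset.all_card_le_biUnion_card_iff_exists_injective _).1 H
    exact ⟨f, hf, fun r => (Finset.mem_filter.1 (hfm r)).2⟩
  intro s
  set U := s.biUnion fun r => Finset.univ.filter fun c => 0 < M r c with hU
  have h : (s.card : ℝ) ≤ U.card := by
    calc (s.card : ℝ) = ∑ r ∈ s, ∑ c, M r c := by simp [hrow]
      _ = ∑ r ∈ s, ∑ c ∈ U, M r c := by
        refine Finset.sum_congr rfl fun r hr => (Finset.sum_subset (Finset.subset_univ _) ?_).symm
        intro c _ hc
        by_contra hne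
        exact hc (Finset.mem_biUnion.2 ⟨r, hr, Finset.mem_filter.2
          ⟨Finset.mem_univ _, lt_of_le_of_ne (h0 r c) (Ne.symm hne)⟩⟩)
      _ = ∑ c ∈ U, ∑ r ∈ s, M r c := Finset.sum_comm
      _ ≤ ∑ c ∈ U, 1 := Finset.sum_le_sum fun c _ =>
        (Finset.sum_le_sum_of_subset_of_nonneg (Finset.subset_univ _)
          fun r _ _ => h0 r c).trans (hcol c)
      _ = U.card := by simp
  exact_mod_cast h

/-- All fibres of an assignment have a size strictly within one of the average. -/
def IsBalanced {ι Q : Type*} [Fintype ι] [Fintype Q] (ρ : ι → Q) : Prop :=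
  ∀ j, Fintype.card ι < Fintype.card Q * (Nat.card {i // ρ i = j} + 1) ∧
    Fintype.card Q * Nat.card {i // ρ i = j} < Fintype.card ι + Fintype.card Q

theorem exists_balanced_rounding {ι Q : Type*} [Fintype ι] [Fintype Q] {φ : ι → Q → ℝ}
    (h0 : ∀ i j, 0 ≤ φ i j) (hrow : ∀ i, ∑ j, φ i j = 1)
    (hcol : ∀ j j', ∑ i, φ i j = ∑ i, φ i j') :
    ∃ ρ : ι → Q, IsBalanced ρ ∧ ∀ i, 0 < φ i (ρ i) := by
  classical
  rcases isEmpty_or_nonempty Q with hQ | hQ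
  · have : IsEmpty ι := ⟨fun i => by simpa using hrow i⟩
    exact ⟨isEmptyElim, fun j => isEmptyElim j, isEmptyElim⟩
  set n := Fintype.card ι with hn
  set p := Fintype.card Q with hp
  have hp0 : 0 < p := Fintype.card_pos
  have hpr : (0 : ℝ) < p := by exact_mod_cast hp0
  set a := n / p with ha
  set b := n % p with hb
  have hbp : b < p := Nat.mod_lt _ hp0
  have hn' : p * a + b = n := Nat.div_add_mod n p
  have hnr : (p : ℝ) * a + b = n := by exact_mod_cast hn'
  have hcol' : ∀ j, ∑ i, φ i j = n / p := by
    intro j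
    have h1 : ∑ j', ∑ i, φ i j' = n := by
      rw [Finset.sum_comm]
      simp [hrow, hn]
    simp only [hcol _ j, Finset.sum_const, Finset.card_univ, nsmul_eq_mul] at h1
    rw [eq_div_iff hpr.ne', mul_comm]
    exact h1
  let M : ι ⊕ Fin (p - b) → Q × Option (Fin a) → ℝ := fun r c =>
    Sum.elim (fun i => c.2.elim (φ i c.1 * (b / n)) fun _ => φ i c.1 * (p / n))
      (fun _ => c.2.elim (1 / p) fun _ => 0) r
  obtain ⟨f, hf, hfM⟩ := exists_injective_of_fractional_matching (M := M) (by
      rintro (i | i) ⟨j, _ | l⟩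
      · exact mul_nonneg (h0 _ _) (by positivity)
      · exact mul_nonneg (h0 _ _) (by positivity)
      · exact (by positivity : (0 : ℝ) ≤ 1 / p)
      · exact le_rfl) (by
      rintro (i | i)
      · have hn0 : (n : ℝ) ≠ 0 := by
          have : 0 < n := Fintype.card_pos_iff.2 ⟨i⟩
          exact_mod_cast this.ne'
        simp only [M, Fintype.sum_prod_type, Fintype.sum_option, Sum.elim_inl, Option.elim,
          Finset.sum_const, Finset.card_univ, Fintype.card_fin, nsmul_eq_mul]
        have : ∀ j, φ i j * (b / n) + a * (φ i j * (p / n)) = φ i j := by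
          intro j
          field_simp
          rw [← hnr]
          ring
        simp [this, hrow]
      · simp only [M, Fintype.sum_prod_type, Fintype.sum_option, Sum.elim_inr, Option.elim]
        simp [← hp, hpr.ne']) (by
      rintro ⟨j, _ | l⟩
      · simp only [M, Fintype.sum_sum_type, Sum.elim_inl, Option.elim, Sum.elim_inr,
          ← Finset.sum_mul, hcol', Finset.sum_const, Finset.card_univ, Fintype.card_fin,
          nsmul_eq_mul, Nat.cast_sub hbp.le]
        have h1 : (n : ℝ) / p * (b / n) ≤ b / p := by
          rcases eq_or_ne (n : ℝ) 0 with h | h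
          · simp only [h, zero_div, zero_mul]
            positivity
          · exact le_of_eq (by field_simp)
        calc (n : ℝ) / p * (b / n) + (p - b) * (1 / p) ≤ b / p + (p - b) * (1 / p) := by gcongr
          _ = 1 := by field_simp; ring
      · simp only [M, Fintype.sum_sum_type, Sum.elim_inl, Option.elim, Sum.elim_inr,
          ← Finset.sum_mul, hcol', Finset.sum_const_zero, add_zero]
        rcases eq_or_ne (n : ℝ) 0 with h | h
        · simp [h]
        · exact le_of_eq (by field_simp))
  have hbij : Function.Bijective f := by
    refine (Fintype.bijective_iff_injective_and_card f).2 ⟨hf, ?_⟩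
    simp only [Fintype.card_sum, Fintype.card_fin, Fintype.card_prod, Fintype.card_option, ← hn,
      ← hp]
    rw [mul_add]
    omega
  refine ⟨fun i => (f (Sum.inl i)).1, fun j => ?_, fun i => ?_⟩
  · have hinj : Function.Injective fun i : {i // (f (Sum.inl i)).1 = j} =>
        (f (Sum.inl i.1)).2 := by
      rintro ⟨i, hi⟩ ⟨i', hi'⟩ h
      have := hf (Prod.ext (hi.trans hi'.symm) h)
      simpa using this
    have hlow : a ≤ Nat.card {i // (f (Sum.inl i)).1 = j} := by
      have hex : ∀ l : Fin a, ∃ i, f (Sum.inl i) = (j, some l) := by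
        intro l
        obtain ⟨r | r, hr⟩ := hbij.2 (j, some l)
        · exact ⟨r, hr⟩
        · have := hfM (Sum.inr r)
          rw [hr] at this
          exact absurd this (lt_irrefl _)
      choose g hg using hex
      have := Nat.card_le_card_of_injective
        (fun l : Fin a => (⟨g l, by rw [hg]⟩ : {i // (f (Sum.inl i)).1 = j})) (by
          intro l l' h
          have h1 : g l = g l' := congrArg Subtype.val h
          have h2 := hg l
          rw [h1, hg] at h2
          simpa using h2.symm)
      simpa using this
    have hup : Nat.card {i // (f (Sum.inl i)).1 = j} ≤ a + 1 := by
      have := Nat.card_le_card_of_injective _ hinj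
      simpa using this
    have hup' : b = 0 → Nat.card {i // (f (Sum.inl i)).1 = j} ≤ a := by
      intro hb0
      have hsome : ∀ i, ((f (Sum.inl i)).2).isSome := by
        intro i
        have h1 := hfM (Sum.inl i)
        rw [Option.isSome_iff_ne_none]
        intro h2
        simp [M, h2, hb0] at h1
      have := Nat.card_le_card_of_injective
        (fun i : {i // (f (Sum.inl i)).1 = j} => ((f (Sum.inl i.1)).2).get (hsome i.1)) (by
          intro i i' h
          exact hinj (Option.get_inj.1 h))
      simpa using this
    constructor
    · calc n < p * (a + 1) := by rw [mul_add]; omega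
        _ ≤ _ := by gcongr
    · rcases Nat.eq_zero_or_pos b with h | h
      · calc p * _ ≤ p * a := by gcongr; exact hup' h
          _ < n + p := by omega
      · calc p * _ ≤ p * (a + 1) := by gcongr
          _ < n + p := by rw [mul_add]; omega
  · have h1 := hfM (Sum.inl i)
    rcases (h0 i (f (Sum.inl i)).1).lt_or_eq with h | h
    · exact h
    · exfalso
      rcases h2 : (f (Sum.inl i)).2 with _ | l <;> simp [M, h2, ← h] at h1

end Rounding

/-! ### Equivariant choice of a maximiser -/

section EquivariantChoice

variable {k : ℕ}

theorem nsmul_one_eq_one {n : ℕ} (h : n % (k + 1) = 1) : n • (1 : Fin (k + 1)) = 1 := by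
  have h0 : (k + 1) • (1 : Fin (k + 1)) = 0 := by
    simpa using card_nsmul_eq_zero' (x := (1 : Fin (k + 1)))
  rw [← Nat.mod_add_div n (k + 1), h, add_nsmul, one_nsmul, mul_comm, mul_nsmul', h0]
  simp

theorem exists_equivariant_choice (hp : (k + 1).Prime) :
    ∃ L : Finset (Fin (k + 1)) → Fin (k + 1), ∀ A : Finset (Fin (k + 1)), A.Nonempty →
      A ≠ Finset.univ → L A ∈ A ∧ L (A.image (shift k)) = shift k (L A) := by
  have hinv : ∀ a : ℕ, ∃ c : ℕ, 0 < a → a < k + 1 → a * c % (k + 1) = 1 := by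
    intro a
    by_cases h : 0 < a ∧ a < k + 1
    · obtain ⟨c, hc⟩ := Nat.exists_mul_mod_eq_one_of_coprime
        (Nat.coprime_of_lt_prime h.1.ne' h.2 hp).symm hp.one_lt
      exact ⟨c, fun _ _ => hc.2⟩
    · exact ⟨0, fun h1 h2 => absurd ⟨h1, h2⟩ h⟩
  choose c hc using hinv
  let m : Finset (Fin (k + 1)) → Fin (k + 1) := fun A => c A.card • ∑ a ∈ A, a
  let B : Finset (Fin (k + 1)) → Finset (Fin (k + 1)) := fun A => A.image fun a => a - m A
  let L : Finset (Fin (k + 1)) → Fin (k + 1) := fun A =>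
    m A + if h : (B A).Nonempty then (B A).min' h else 0
  refine ⟨L, fun A hA hA' => ⟨?_, ?_⟩⟩
  · have hB : (B A).Nonempty := hA.image _
    obtain ⟨a, ha, h⟩ := Finset.mem_image.1 ((B A).min'_mem hB)
    have : L A = a := by
      simp only [L, dif_pos hB, ← h]
      abel
    rwa [this]
  · have hcard : (A.image (shift k)).card = A.card :=
      Finset.card_image_of_injective _ (shift k).injective
    have hlt : A.card < k + 1 := by
      simpa only [Fintype.card_fin] using (Finset.card_lt_iff_ne_univ A).2 hA'
    have hm : m (A.image (shift k)) = m A + 1 := by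
      simp only [m, hcard]
      rw [Finset.sum_image (fun a _ b _ h => (shift k).injective h)]
      simp only [shift_apply, Finset.sum_add_distrib, Finset.sum_const, nsmul_add]
      rw [← mul_nsmul, nsmul_one_eq_one (hc _ hA.card_pos hlt)]
    have hB : B (A.image (shift k)) = B A := by
      simp only [B, hm, Finset.image_image]
      congr 1
      funext a
      simp [shift_apply]
    simp only [L, hB, hm, shift_apply]
    abel

end EquivariantChoice

/-! ### Balanced points of equivariant families -/

section BalancedPoint

open Filter Topology

theorem exists_tendsto_subseq {α X : Type*} [Finite α] [TopologicalSpace X]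
    [FirstCountableTopology X] {K : Set X} (hK : IsCompact K) (a : ℕ → α) {x : ℕ → X}
    (hx : ∀ N, x N ∈ K) :
    ∃ a₀, ∃ x₀ ∈ K, ∃ φ : ℕ → ℕ, StrictMono φ ∧ (∀ N, a (φ N) = a₀) ∧
      Tendsto (x ∘ φ) atTop (𝓝 x₀) := by
  obtain ⟨a₀, ha₀⟩ := Finite.exists_infinite_fiber a
  have hinf : (a ⁻¹' {a₀}).Infinite := Set.infinite_coe_iff.1 ha₀
  obtain ⟨φ, hφ, hφa⟩ := extraction_of_frequently_atTop (Nat.frequently_atTop_iff_infinite.2 hinf)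
  obtain ⟨x₀, hx₀, ψ, hψ, hlim⟩ := hK.tendsto_subseq fun N => hx (φ N)
  exact ⟨a₀, x₀, hx₀, φ ∘ ψ, hφ.comp hψ, fun N => hφa (ψ N), hlim⟩

variable {k : ℕ}

/-- A family of functions on ordered cells: continuous on cells, dependent only on the order of
the letters of nonzero weight, and commuting with the cyclic shift. -/
structure IsEquivariantFamily
    (F : Equiv.Perm (Fin (k + 1)) → (Fin (k + 1) → ℝ) → Fin (k + 1) → ℝ) : Prop where
  continuous : ∀ π j, Continuous fun x => F π x j
  congr : ∀ π π' x, (∀ s t, x s ≠ 0 → x t ≠ 0 → (π.symm s < π.symm t ↔ π'.symm s < π'.symm t)) →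
    F π x = F π' x
  shift : ∀ π x j, F (shift k * π) (shiftMap k x) (shift k j) = F π x j

variable {F : Equiv.Perm (Fin (k + 1)) → (Fin (k + 1) → ℝ) → Fin (k + 1) → ℝ}

theorem IsEquivariantFamily.exists_labelling (hF : IsEquivariantFamily F) (hp : (k + 1).Prime)
    (hne : ∀ π, ∀ x ∈ stdSimplex ℝ (Fin (k + 1)), ∃ j j', F π x j ≠ F π x j') :
    ∃ Λ, IsEquivariantLabelling Λ ∧
      ∀ π, ∀ x ∈ stdSimplex ℝ (Fin (k + 1)), ∀ j, F π x j ≤ F π x (Λ π x) := by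
  classical
  obtain ⟨L, hL⟩ := exists_equivariant_choice hp
  let A : (Fin (k + 1) → ℝ) → Finset (Fin (k + 1)) := fun f =>
    Finset.univ.filter fun j => ∀ j', f j' ≤ f j
  have hA : ∀ f, (A f).Nonempty := by
    intro f
    obtain ⟨j, hj⟩ := Finite.exists_max f
    exact ⟨j, by simpa [A] using hj⟩
  have hA' : ∀ π, ∀ x ∈ stdSimplex ℝ (Fin (k + 1)), A (F π x) ≠ Finset.univ := by
    intro π x hx h
    obtain ⟨j, j', hjj⟩ := hne π x hx
    have hall : ∀ j j', F π x j' ≤ F π x j := by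
      simpa [A, Finset.eq_univ_iff_forall] using h
    exact hjj (le_antisymm (hall _ _) (hall _ _))
  refine ⟨fun π x => L (A (F π x)), ⟨fun π π' x _ h => ?_, fun π x hx => ?_⟩, fun π x hx => ?_⟩
  · rw [hF.congr π π' x h]
  · rw [← (hL _ (hA _) (hA' π x hx)).2]
    congr 1
    ext j
    obtain ⟨j, rfl⟩ := (_root_.shift k).surjective j
    simp only [A, Finset.mem_filter, Finset.mem_univ, true_and, Finset.mem_image,
      EmbeddingLike.apply_eq_iff_eq, exists_eq_right, hF.shift]
    rw [(_root_.shift k).surjective.forall]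
    simp only [hF.shift]
  · simpa [A] using (hL _ (hA _) (hA' π x hx)).1

theorem IsEquivariantFamily.exists_constant (hF : IsEquivariantFamily F) (hp : (k + 1).Prime) :
    ∃ π, ∃ x ∈ stdSimplex ℝ (Fin (k + 1)), ∀ j j', F π x j = F π x j' := by
  by_contra! hne
  obtain ⟨Λ, hΛ, hmax⟩ := hF.exists_labelling hp hne
  choose π τ hτ hsurj using exists_small_rainbow hp hΛ
  obtain ⟨π₀, x₀, hx₀, φ, hφ, hπ, hlim⟩ := exists_tendsto_subseq (isCompact_stdSimplex ℝ _) π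
    (x := fun N => τ N 0) fun N => (hτ N).1 0
  obtain ⟨j, j', hjj⟩ := hne π₀ x₀ hx₀
  have hle : ∀ j j', F π₀ x₀ j' ≤ F π₀ x₀ j := by
    intro j j'
    choose i hi using fun N => hsurj N j
    have hr : Tendsto (fun N => (1 - 1 / (k + 1 : ℝ)) ^ φ N) atTop (𝓝 0) := by
      refine (tendsto_pow_atTop_nhds_zero_of_lt_one ?_ ?_).comp hφ.tendsto_atTop
      · rw [sub_nonneg, div_le_one (by positivity)]
        simp
      · rw [sub_lt_self_iff]
        positivity
    have hlim' : Tendsto (fun N => τ (φ N) (i (φ N))) atTop (𝓝 x₀) := by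
      refine tendsto_of_tendsto_of_dist hlim
        (squeeze_zero (fun _ => dist_nonneg) (fun N => ?_) hr)
      exact (hτ (φ N)).2 _ _
    refine le_of_tendsto_of_tendsto' (((hF.continuous π₀ j').tendsto x₀).comp hlim')
      (((hF.continuous π₀ j).tendsto x₀).comp hlim') fun N => ?_
    have h1 := hmax (π (φ N)) _ ((hτ (φ N)).1 (i (φ N))) j'
    have h2 : Λ (π (φ N)) (τ (φ N) (i (φ N))) = j := hi (φ N)
    rw [h2, hπ] at h1
    exact h1
  exact hjj (le_antisymm (hle _ _) (hle _ _))

theorem exists_balanced_nonneg {ι : Type*} [Fintype ι] (hp : (k + 1).Prime)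
    {G : ι → Equiv.Perm (Fin (k + 1)) → (Fin (k + 1) → ℝ) → Fin (k + 1) → ℝ}
    (hG : ∀ i, IsEquivariantFamily (G i))
    (hsum : ∀ i π, ∀ x ∈ stdSimplex ℝ (Fin (k + 1)), ∑ j, G i π x j = 0) :
    ∃ π, ∃ x ∈ stdSimplex ℝ (Fin (k + 1)), ∃ ρ : ι → Fin (k + 1),
      IsBalanced ρ ∧ ∀ i, 0 ≤ G i π x (ρ i) := by
  have key : ∀ N : ℕ, ∃ a : Equiv.Perm (Fin (k + 1)) × (ι → Fin (k + 1)),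
      ∃ x ∈ stdSimplex ℝ (Fin (k + 1)), IsBalanced a.2 ∧
        ∀ i, -(1 / (N + 1 : ℝ)) ≤ G i a.1 x (a.2 i) := by
    intro N
    have hε : (0 : ℝ) < 1 / (N + 1 : ℝ) := by positivity
    set ε := 1 / (N + 1 : ℝ)
    let w : ι → Equiv.Perm (Fin (k + 1)) → (Fin (k + 1) → ℝ) → Fin (k + 1) → ℝ :=
      fun i π x j => max (G i π x j + ε) 0
    let φ : ι → Equiv.Perm (Fin (k + 1)) → (Fin (k + 1) → ℝ) → Fin (k + 1) → ℝ :=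
      fun i π x j => w i π x j / max (∑ j', w i π x j') ε
    have hwc : ∀ i π j, Continuous fun x => w i π x j := fun i π j =>
      (((hG i).continuous π j).add continuous_const).max continuous_const
    have hφ : ∀ i, IsEquivariantFamily (φ i) := by
      intro i
      have hws : ∀ π x j, w i (shift k * π) (shiftMap k x) (shift k j) = w i π x j := by
        intro π x j
        simp only [w, (hG i).shift]
      refine ⟨fun π j => ?_, fun π π' x h => ?_, fun π x j => ?_⟩
      · exact (hwc i π j).div ((continuous_finsetSum _ fun j' _ => hwc i π j').max
          continuous_const) fun x => (lt_max_of_lt_right hε).ne'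
      · simp only [φ, w, (hG i).congr π π' x h]
      · simp only [φ, hws]
        rw [← Equiv.sum_comp (shift k)]
        simp only [hws]
    have hF : IsEquivariantFamily fun π x j => ∑ i, φ i π x j :=
      ⟨fun π j => continuous_finsetSum _ fun i _ => (hφ i).continuous π j,
        fun π π' x h => by simp only [(hφ _).congr π π' x h],
        fun π x j => by simp only [(hφ _).shift]⟩
    obtain ⟨π, x, hx, hconst⟩ := hF.exists_constant hp
    have hw0 : ∀ i j, 0 ≤ w i π x j := fun i j => le_max_right _ _
    have hrow : ∀ i, ∑ j, φ i π x j = 1 := by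
      intro i
      have h1 : ε ≤ ∑ j, w i π x j := by
        calc ε ≤ ∑ j : Fin (k + 1), (G i π x j + ε) := by
              rw [Finset.sum_add_distrib, hsum i π x hx]
              simp only [Finset.sum_const, Finset.card_univ, Fintype.card_fin, nsmul_eq_mul]
              push_cast
              nlinarith [(Nat.cast_nonneg k : (0 : ℝ) ≤ k)]
          _ ≤ _ := Finset.sum_le_sum fun j _ => le_max_left _ _
      simp only [φ, max_eq_left h1, ← Finset.sum_div]
      exact div_self (hε.trans_le h1).ne'
    obtain ⟨ρ, hρ, hpos⟩ := exists_balanced_rounding (φ := fun i j => φ i π x j)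
      (fun i j => div_nonneg (hw0 i j) (hε.le.trans (le_max_right _ _))) hrow hconst
    refine ⟨(π, ρ), x, hx, hρ, fun i => ?_⟩
    by_contra! hlt
    have h1 : w i π x (ρ i) = 0 := max_eq_right (by linarith)
    have h2 := hpos i
    simp only [φ, h1, zero_div, lt_irrefl] at h2
  choose a x hx hbal hle using key
  obtain ⟨a₀, x₀, hx₀, φ, hφ, ha, hlim⟩ := exists_tendsto_subseq (isCompact_stdSimplex ℝ _) a hx
  refine ⟨a₀.1, x₀, hx₀, a₀.2, ha 0 ▸ hbal (φ 0), fun i => ?_⟩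
  have h0 : Tendsto (fun N => -(1 / ((φ N : ℝ) + 1))) atTop (𝓝 0) := by
    have h1 := ((tendsto_one_div_add_atTop_nhds_zero_nat (𝕜 := ℝ)).comp hφ.tendsto_atTop).neg
    rwa [neg_zero] at h1
  refine le_of_tendsto_of_tendsto' h0
    ((((hG i).continuous a₀.1 (a₀.2 i)).tendsto x₀).comp hlim) fun N => ?_
  have := hle (φ N) i
  rw [ha] at this
  exact this

end BalancedPoint

/-! ### Slots of an ordered cell -/

section Slots

variable {k : ℕ}

/-- The `n`-th cut point: the total weight of the first `n` letters. -/
noncomputable def cut (π : Equiv.Perm (Fin (k + 1))) (x : Fin (k + 1) → ℝ) (n : ℕ) : ℝ :=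
  ∑ t, if (π.symm t : ℕ) < n then x t else 0

theorem continuous_cut (π : Equiv.Perm (Fin (k + 1))) (n : ℕ) : Continuous fun x => cut π x n := by
  refine continuous_finsetSum _ fun t _ => ?_
  split_ifs
  · exact continuous_apply t
  · exact continuous_const

theorem cut_zero (π : Equiv.Perm (Fin (k + 1))) (x : Fin (k + 1) → ℝ) : cut π x 0 = 0 := by
  simp [cut]

theorem cut_last (π : Equiv.Perm (Fin (k + 1))) {x : Fin (k + 1) → ℝ}
    (hx : x ∈ stdSimplex ℝ (Fin (k + 1))) : cut π x (k + 1) = 1 := by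
  rw [cut, ← hx.2]
  exact Finset.sum_congr rfl fun t _ => if_pos (π.symm t).is_lt

theorem cut_mono (π : Equiv.Perm (Fin (k + 1))) {x : Fin (k + 1) → ℝ}
    (hx : x ∈ stdSimplex ℝ (Fin (k + 1))) : Monotone (cut π x) := by
  intro a b hab
  refine Finset.sum_le_sum fun t _ => ?_
  split_ifs with h1 h2 h2
  · exact le_rfl
  · exact absurd (h1.trans_le hab) h2
  · exact hx.1 t
  · exact le_rfl

/-- Left end of the slot of a letter. -/
noncomputable def slotLeft (π : Equiv.Perm (Fin (k + 1))) (x : Fin (k + 1) → ℝ)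
    (s : Fin (k + 1)) : ℝ := cut π x (π.symm s)

/-- Right end of the slot of a letter. -/
noncomputable def slotRight (π : Equiv.Perm (Fin (k + 1))) (x : Fin (k + 1) → ℝ)
    (s : Fin (k + 1)) : ℝ := cut π x (π.symm s + 1)

theorem slotRight_eq (π : Equiv.Perm (Fin (k + 1))) (x : Fin (k + 1) → ℝ) (s : Fin (k + 1)) :
    slotRight π x s = slotLeft π x s + x s := by
  have : x s = ∑ t, if t = s then x t else 0 := by simp
  rw [slotRight, slotLeft, cut, cut, this, ← Finset.sum_add_distrib]
  refine Finset.sum_congr rfl fun t _ => ?_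
  by_cases h : t = s
  · subst h
    simp
  · have hne : (π.symm t : ℕ) ≠ π.symm s := fun h' => h (π.symm.injective (Fin.ext h'))
    have hiff : (π.symm t : ℕ) < π.symm s + 1 ↔ (π.symm t : ℕ) < π.symm s := by omega
    simp [h, hiff]

theorem slotLeft_congr {π π' : Equiv.Perm (Fin (k + 1))} {x : Fin (k + 1) → ℝ} {s : Fin (k + 1)}
    (h : ∀ t, x t ≠ 0 → (π.symm t < π.symm s ↔ π'.symm t < π'.symm s)) :
    slotLeft π x s = slotLeft π' x s := by
  rw [slotLeft, slotLeft, cut, cut]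
  refine Finset.sum_congr rfl fun t _ => ?_
  by_cases ht : x t = 0
  · simp [ht]
  · have := h t ht
    simp only [Fin.lt_def] at this
    simp only [this]

theorem slotLeft_shift (π : Equiv.Perm (Fin (k + 1))) (x : Fin (k + 1) → ℝ) (s : Fin (k + 1)) :
    slotLeft (shift k * π) (shiftMap k x) (shift k s) = slotLeft π x s := by
  have h : ∀ t, (shift k * π).symm t = π.symm ((shift k).symm t) := fun t => rfl
  simp only [slotLeft, cut, h, shiftMap_apply, Equiv.symm_apply_apply]
  exact Equiv.sum_comp (shift k).symm fun t => if (π.symm t : ℕ) < π.symm s then x t else 0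

theorem slotRight_shift (π : Equiv.Perm (Fin (k + 1))) (x : Fin (k + 1) → ℝ) (s : Fin (k + 1)) :
    slotRight (shift k * π) (shiftMap k x) (shift k s) = slotRight π x s := by
  rw [slotRight_eq, slotRight_eq, slotLeft_shift, shiftMap_apply, Equiv.symm_apply_apply]

theorem sum_slots (π : Equiv.Perm (Fin (k + 1))) {x : Fin (k + 1) → ℝ}
    (hx : x ∈ stdSimplex ℝ (Fin (k + 1))) (g : ℝ → ℝ) :
    ∑ s, (g (slotRight π x s) - g (slotLeft π x s)) = g 1 - g 0 := by
  rw [← Equiv.sum_comp π]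
  simp only [slotRight, slotLeft, Equiv.symm_apply_apply]
  rw [Fin.sum_univ_eq_sum_range (fun a => g (cut π x (a + 1)) - g (cut π x a)),
    Finset.sum_range_sub (fun a => g (cut π x a)), cut_last π hx, cut_zero]

/-- The surplus over the fair share of the piece `j` which takes layer `j - s` in slot `s`. -/
noncomputable def surplus (h : Fin (k + 1) → ℝ → ℝ) (π : Equiv.Perm (Fin (k + 1)))
    (x : Fin (k + 1) → ℝ) (j : Fin (k + 1)) : ℝ :=
  ∑ s, (h (j - s) (slotRight π x s) - h (j - s) (slotLeft π x s)) -
    1 / (k + 1 : ℝ) * ∑ l, (h l 1 - h l 0)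

theorem sum_surplus (h : Fin (k + 1) → ℝ → ℝ) (π : Equiv.Perm (Fin (k + 1)))
    {x : Fin (k + 1) → ℝ} (hx : x ∈ stdSimplex ℝ (Fin (k + 1))) : ∑ j, surplus h π x j = 0 := by
  have h1 : ∑ j, ∑ s, (h (j - s) (slotRight π x s) - h (j - s) (slotLeft π x s)) =
      ∑ l, (h l 1 - h l 0) := by
    have h2 : ∑ l, (h l 1 - h l 0) =
        ∑ l, ∑ s, (h l (slotRight π x s) - h l (slotLeft π x s)) := by
      simp only [sum_slots π hx]
    rw [h2, Finset.sum_comm]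
    refine Eq.trans ?_ Finset.sum_comm
    refine Finset.sum_congr rfl fun s _ => ?_
    exact Equiv.sum_comp (Equiv.subRight s)
      fun l => h l (slotRight π x s) - h l (slotLeft π x s)
  have hk : (k + 1 : ℝ) ≠ 0 := by positivity
  simp only [surplus, Finset.sum_sub_distrib _ (fun _ => 1 / (k + 1 : ℝ) * _), h1,
    Finset.sum_const, Finset.card_univ, Fintype.card_fin, nsmul_eq_mul]
  push_cast
  field_simp
  ring

theorem isEquivariantFamily_surplus {h : Fin (k + 1) → ℝ → ℝ} (hc : ∀ l, Continuous (h l)) :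
    IsEquivariantFamily (surplus h) := by
  refine ⟨fun π j => ?_, fun π π' x hx => ?_, fun π x j => ?_⟩
  · refine (continuous_finsetSum _ fun s _ => ?_).sub continuous_const
    exact ((hc _).comp (continuous_cut π _)).sub ((hc _).comp (continuous_cut π _))
  · funext j
    rw [surplus, surplus]
    congr 1
    refine Finset.sum_congr rfl fun s _ => ?_
    by_cases hs : x s = 0
    · simp [slotRight_eq, hs]
    · rw [slotRight_eq, slotRight_eq, slotLeft_congr fun t ht => hx t s ht hs]
  · rw [surplus, surplus, ← Equiv.sum_comp (shift k)]
    simp only [slotRight_shift, slotLeft_shift]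
    simp only [shift_apply, add_sub_add_right_eq_sub]

/-- Two intervals, given by their ends, do not overlap. -/
def Separated (a b a' b' : ℝ) : Prop := b ≤ a' ∨ b' ≤ a

theorem separated_slots (π : Equiv.Perm (Fin (k + 1))) {x : Fin (k + 1) → ℝ}
    (hx : x ∈ stdSimplex ℝ (Fin (k + 1))) {s t : Fin (k + 1)} (hst : s ≠ t) :
    Separated (slotLeft π x s) (slotRight π x s) (slotLeft π x t) (slotRight π x t) := by
  have hne : (π.symm s : ℕ) ≠ π.symm t := fun h' => hst (π.symm.injective (Fin.ext h'))
  rcases hne.lt_or_gt with h | h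
  · exact Or.inl (cut_mono π hx h)
  · exact Or.inr (cut_mono π hx h)

theorem slotLeft_nonneg (π : Equiv.Perm (Fin (k + 1))) {x : Fin (k + 1) → ℝ}
    (hx : x ∈ stdSimplex ℝ (Fin (k + 1))) (s : Fin (k + 1)) : 0 ≤ slotLeft π x s := by
  rw [← cut_zero π x]
  exact cut_mono π hx (Nat.zero_le _)

theorem slotLeft_le_slotRight (π : Equiv.Perm (Fin (k + 1))) {x : Fin (k + 1) → ℝ}
    (hx : x ∈ stdSimplex ℝ (Fin (k + 1))) (s : Fin (k + 1)) :
    slotLeft π x s ≤ slotRight π x s :=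
  cut_mono π hx (Nat.le_succ _)

theorem slotRight_le_one (π : Equiv.Perm (Fin (k + 1))) {x : Fin (k + 1) → ℝ}
    (hx : x ∈ stdSimplex ℝ (Fin (k + 1))) (s : Fin (k + 1)) : slotRight π x s ≤ 1 := by
  rw [← cut_last π hx]
  exact cut_mono π hx (π.symm s).is_lt

theorem exists_mem_slot (π : Equiv.Perm (Fin (k + 1))) {x : Fin (k + 1) → ℝ}
    (hx : x ∈ stdSimplex ℝ (Fin (k + 1))) {t : ℝ} (ht : t ∈ Set.Icc (0 : ℝ) 1) :
    ∃ s, slotLeft π x s ≤ t ∧ t ≤ slotRight π x s := by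
  classical
  have hex : ∃ n, t ≤ cut π x (n + 1) := ⟨k, by rw [cut_last π hx]; exact ht.2⟩
  have hlt : Nat.find hex < k + 1 :=
    Nat.lt_succ_of_le (Nat.find_min' hex (by rw [cut_last π hx]; exact ht.2))
  refine ⟨π ⟨Nat.find hex, hlt⟩, ?_, ?_⟩
  · simp only [slotLeft, Equiv.symm_apply_apply]
    rcases hn : Nat.find hex with _ | n
    · rw [cut_zero]
      exact ht.1
    · have := Nat.find_min hex (m := n) (by omega)
      exact (not_le.1 this).le
  · simp only [slotRight, Equiv.symm_apply_apply]
    exact Nat.find_spec hex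

end Slots

/-! ### Divisions of cakes with as many layers as pieces -/

section Divisions

/-- A contiguous feasible multi-division: piece `j` takes the interval from `lo j l` to `hi j l`
of layer `l`. -/
structure IsDivision {Q : Type*} (lo hi : Q → Q → ℝ) : Prop where
  nonneg : ∀ j l, 0 ≤ lo j l
  le : ∀ j l, lo j l ≤ hi j l
  le_one : ∀ j l, hi j l ≤ 1
  feasible : ∀ j l l', l ≠ l' → Separated (lo j l) (hi j l) (lo j l') (hi j l')
  disjoint : ∀ l j j', j ≠ j' → Separated (lo j l) (hi j l) (lo j' l) (hi j' l)
  cover : ∀ l, ∀ t ∈ Set.Icc (0 : ℝ) 1, ∃ j, lo j l ≤ t ∧ t ≤ hi j l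

/-- Every family of agents with continuous cumulative value functions admits a proportional
balanced multi-division into pieces indexed by `Q`. -/
def Divisible (Q : Type) [Fintype Q] : Prop :=
  ∀ (ι : Type) [Fintype ι] (f : ι → Q → ℝ → ℝ), (∀ i l, Continuous (f i l)) →
    ∃ lo hi : Q → Q → ℝ, IsDivision lo hi ∧ ∃ ρ : ι → Q, IsBalanced ρ ∧
      ∀ i, 1 / (Fintype.card Q : ℝ) * ∑ l, (f i l 1 - f i l 0) ≤
        ∑ l, (f i l (hi (ρ i) l) - f i l (lo (ρ i) l))

theorem Divisible.of_equiv {Q R : Type} [Fintype Q] [Fintype R] (e : Q ≃ R) (h : Divisible Q) :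
    Divisible R := by
  intro ι _ f hf
  obtain ⟨lo, hi, hd, ρ, hρ, hle⟩ := h ι (fun i l => f i (e l)) fun i l => hf i (e l)
  refine ⟨fun j l => lo (e.symm j) (e.symm l), fun j l => hi (e.symm j) (e.symm l),
    ⟨fun _ _ => hd.nonneg _ _, fun _ _ => hd.le _ _, fun _ _ => hd.le_one _ _,
      fun _ _ _ hne => hd.feasible _ _ _ (e.symm.injective.ne hne),
      fun _ _ _ hne => hd.disjoint _ _ _ (e.symm.injective.ne hne), fun l t ht => ?_⟩,
    fun i => e (ρ i), fun j => ?_, fun i => ?_⟩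
  · obtain ⟨j, hj⟩ := hd.cover (e.symm l) t ht
    exact ⟨e j, by simpa using hj⟩
  · have := hρ (e.symm j)
    simpa only [Equiv.eq_symm_apply, Fintype.card_congr e] using this
  · have := hle i
    rw [Fintype.card_congr e, e.sum_comp fun l => f i l 1 - f i l 0] at this
    refine this.trans (le_of_eq ?_)
    rw [← e.sum_comp]
    simp

theorem divisible_of_unique (Q : Type) [Fintype Q] [Unique Q] : Divisible Q := by
  intro ι _ f _
  refine ⟨fun _ _ => 0, fun _ _ => 1, ⟨fun _ _ => le_rfl, fun _ _ => zero_le_one,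
    fun _ _ => le_rfl, fun _ l l' h => absurd (Subsingleton.elim l l') h,
    fun _ l l' h => absurd (Subsingleton.elim l l') h, fun l t ht => ⟨default, ht⟩⟩,
    fun _ => default, fun j => ?_, fun i => ?_⟩
  · have : Nat.card {_i : ι // (default : Q) = j} = Fintype.card ι := by
      rw [← Nat.card_eq_fintype_card]
      exact Nat.card_congr (Equiv.subtypeUnivEquiv fun _ => Subsingleton.elim _ _)
    rw [this]
    simp
  · simp

/-- The point of an interval closest to `t`. -/
def clamp (a b t : ℝ) : ℝ := max a (min t b)

theorem continuous_clamp (a b : ℝ) : Continuous (clamp a b) :=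
  continuous_const.max (continuous_id.min continuous_const)

theorem clamp_mono (a b : ℝ) : Monotone (clamp a b) := fun _ _ h =>
  max_le_max le_rfl (min_le_min h le_rfl)

theorem le_clamp (a b t : ℝ) : a ≤ clamp a b t := le_max_left _ _

theorem clamp_le {a b : ℝ} (h : a ≤ b) (t : ℝ) : clamp a b t ≤ b := max_le h (min_le_right _ _)

theorem clamp_of_mem {a b t : ℝ} (h1 : a ≤ t) (h2 : t ≤ b) : clamp a b t = t := by
  rw [clamp, min_eq_left h2, max_eq_right h1]

theorem clamp_of_ge {a b t : ℝ} (h : a ≤ b) (ht : b ≤ t) : clamp a b t = b := by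
  rw [clamp, min_eq_right ht, max_eq_right h]

theorem clamp_of_le {a b t : ℝ} (ht : t ≤ a) : clamp a b t = a :=
  max_eq_left ((min_le_left _ _).trans ht)

theorem Separated.clamp {a b a' b' : ℝ} (h : Separated a b a' b') (u v : ℝ) :
    Separated (clamp u v a) (clamp u v b) (clamp u v a') (clamp u v b') :=
  h.imp (fun h => clamp_mono u v h) fun h => clamp_mono u v h

theorem Separated.clamp_clamp {a b a' b' : ℝ} (hab : a ≤ b) (hab' : a' ≤ b')
    (h : Separated a b a' b') (u v u' v' : ℝ) :
    Separated (_root_.clamp a b u) (_root_.clamp a b v)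
      (_root_.clamp a' b' u') (_root_.clamp a' b' v') :=
  h.imp (fun h => (clamp_le hab _).trans (h.trans (le_clamp _ _ _)))
    fun h => (clamp_le hab' _).trans (h.trans (le_clamp _ _ _))

theorem IsBalanced.prod {ι P R : Type} [Fintype ι] [Fintype P] [Fintype R] {σ : ι → P}
    (hσ : IsBalanced σ) {ρ : ∀ J, {i // σ i = J} → R}
    (hρ : ∀ J, letI := Fintype.ofFinite {i // σ i = J}; IsBalanced (ρ J)) :
    IsBalanced fun i => (σ i, ρ (σ i) ⟨i, rfl⟩) := by
  rintro ⟨J, K⟩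
  have h1 := hσ J
  have h2 := hρ J K
  have hcard : Nat.card {i // (σ i, ρ (σ i) ⟨i, rfl⟩) = (J, K)} =
      Nat.card {i : {i // σ i = J} // ρ J i = K} := by
    refine Nat.card_congr ⟨fun i => ⟨⟨i.1, (Prod.ext_iff.1 i.2).1⟩, ?_⟩,
      fun i => ⟨i.1.1, ?_⟩, fun _ => rfl, fun _ => rfl⟩
    · obtain ⟨i, hi⟩ := i
      have hJ : σ i = J := congrArg Prod.fst hi
      have hK : ρ (σ i) ⟨i, rfl⟩ = K := congrArg Prod.snd hi
      subst hJ
      exact hK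
    · obtain ⟨⟨i, rfl⟩, h⟩ := i
      exact Prod.ext rfl h
  simp only [← Nat.card_eq_fintype_card] at h1 h2 ⊢
  rw [hcard, Nat.card_prod]
  set c := Nat.card {i : {i // σ i = J} // ρ J i = K}
  set d := Nat.card {i // σ i = J}
  constructor
  · calc Nat.card ι < Nat.card P * (d + 1) := h1.1
      _ ≤ Nat.card P * (Nat.card R * (c + 1)) := Nat.mul_le_mul_left _ h2.1
      _ = _ := (mul_assoc _ _ _).symm
  · have h3 : Nat.card P * (Nat.card R * c + 1) ≤ Nat.card P * (d + Nat.card R) :=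
      Nat.mul_le_mul_left _ h2.2
    have h4 := h1.2
    rw [mul_assoc]
    linarith

theorem Divisible.prod {k : ℕ} (hp : (k + 1).Prime) {R : Type} [Fintype R] (hR : Divisible R) :
    Divisible (Fin (k + 1) × R) := by
  classical
  intro ι _ f hf
  obtain ⟨π, x, hx, σ, hσ, hle⟩ := exists_balanced_nonneg (ι := ι) hp
    (G := fun i => surplus fun g t => ∑ r, f i (g, r) t)
    (fun i => isEquivariantFamily_surplus fun g => continuous_finsetSum _ fun r _ => hf i (g, r))
    (fun i π x hx => sum_surplus _ π hx)
  let C : Fin (k + 1) → ℝ → ℝ := fun s => clamp (slotLeft π x s) (slotRight π x s)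
  have hab := slotLeft_le_slotRight π hx
  have hC0 : ∀ s, C s 0 = slotLeft π x s := fun s => clamp_of_le (slotLeft_nonneg π hx s)
  have hC1 : ∀ s, C s 1 = slotRight π x s := fun s => clamp_of_ge (hab s) (slotRight_le_one π hx s)
  choose lo hi hd ρ hρ hle' using fun J =>
    letI := Fintype.ofFinite {i // σ i = J}
    hR {i // σ i = J} (fun i r t => ∑ g, f i (g, r) (C (J - g) t)) fun i r =>
      continuous_finsetSum _ fun g _ => (hf i (g, r)).comp (continuous_clamp _ _)
  refine ⟨fun j l => C (j.1 - l.1) (lo j.1 j.2 l.2), fun j l => C (j.1 - l.1) (hi j.1 j.2 l.2),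
    ⟨fun j l => ?_, fun j l => ?_, fun j l => ?_, ?_, ?_, ?_⟩,
    fun i => (σ i, ρ (σ i) ⟨i, rfl⟩), hσ.prod hρ, fun i => ?_⟩
  · exact (slotLeft_nonneg π hx _).trans (le_clamp _ _ _)
  · exact clamp_mono _ _ ((hd _).le _ _)
  · exact (clamp_le (hab _) _).trans (slotRight_le_one π hx _)
  · rintro ⟨J, K⟩ ⟨g, r⟩ ⟨g', r'⟩ hne
    by_cases h : g = g'
    · subst h
      exact ((hd J).feasible K r r' fun h => hne (by rw [h])).clamp _ _
    · exact Separated.clamp_clamp (hab _) (hab _)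
        (separated_slots π hx fun h' => h (sub_right_injective h')) _ _ _ _
  · rintro ⟨g, r⟩ ⟨J, K⟩ ⟨J', K'⟩ hne
    by_cases h : J = J'
    · subst h
      exact ((hd J).disjoint r K K' fun h => hne (by rw [h])).clamp _ _
    · exact Separated.clamp_clamp (hab _) (hab _)
        (separated_slots π hx fun h' => h (sub_left_injective h')) _ _ _ _
  · rintro ⟨g, r⟩ t ht
    obtain ⟨s, hs1, hs2⟩ := exists_mem_slot π hx ht
    obtain ⟨K, hK1, hK2⟩ := (hd (s + g)).cover r t ht
    refine ⟨(s + g, K), ?_, ?_⟩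
    · simp only [add_sub_cancel_right]
      rw [← clamp_of_mem hs1 hs2]
      exact clamp_mono _ _ hK1
    · simp only [add_sub_cancel_right]
      rw [← clamp_of_mem hs1 hs2]
      exact clamp_mono _ _ hK2
  · have h1 := hle i
    have h2 := hle' (σ i) ⟨i, rfl⟩
    simp only [hC0, hC1, ← Finset.sum_sub_distrib] at h2
    rw [surplus, sub_nonneg] at h1
    simp only [← Finset.sum_sub_distrib] at h1
    rw [← Equiv.sum_comp (Equiv.subLeft (σ i)) fun s => ∑ r, (f i (σ i - s, r)
      (slotRight π x s) - f i (σ i - s, r) (slotLeft π x s))] at h1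
    simp only [Equiv.subLeft_apply, sub_sub_cancel] at h1
    rw [Fintype.sum_prod_type, Fintype.sum_prod_type_right, Fintype.card_prod, Fintype.card_fin]
    refine le_trans ?_ h2
    rw [Finset.sum_comm (γ := R)]
    calc 1 / (((k + 1) * Fintype.card R : ℕ) : ℝ) *
          ∑ g, ∑ r, (f i (g, r) 1 - f i (g, r) 0)
        = 1 / (Fintype.card R : ℝ) * (1 / (k + 1 : ℝ) *
          ∑ g, ∑ r, (f i (g, r) 1 - f i (g, r) 0)) := by
          push_cast
          rw [← mul_assoc, one_div_mul_one_div, mul_comm (k + 1 : ℝ)]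
      _ ≤ _ := mul_le_mul_of_nonneg_left h1 (by positivity)

theorem divisible_fin {q : ℕ} (hq : 0 < q) : Divisible (Fin q) := by
  induction q using induction_on_primes with
  | zero => exact absurd hq (lt_irrefl _)
  | one => exact divisible_of_unique _
  | prime_mul p a hp ih =>
    obtain ⟨k, rfl⟩ := Nat.exists_eq_succ_of_ne_zero hp.ne_zero
    exact ((ih (Nat.pos_of_mul_pos_left hq)).prod hp).of_equiv finProdFinEquiv

end Divisions

/-! ### Valuations of layered pieces -/

section Valuations

variable {m : ℕ}

/-- The layered piece with a single nonempty layer. -/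
def singleLayer (ℓ : Fin m) (S : Set ℝ) : Fin m → Set ℝ := Function.update (fun _ => ∅) ℓ S

theorem isPiece_empty : IsPiece ∅ := ⟨∅, by simp, by simp⟩

theorem isPiece_Icc {a b : ℝ} (ha : 0 ≤ a) (hb : b ≤ 1) : IsPiece (Set.Icc a b) :=
  ⟨{(a, b)}, by simp [ha, hb], by simp⟩

theorem isLayeredPiece_singleLayer (ℓ : Fin m) {S : Set ℝ} (hS : IsPiece S) :
    IsLayeredPiece (singleLayer ℓ S) := by
  intro ℓ'
  by_cases h : ℓ' = ℓ
  · subst h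
    simpa [singleLayer] using hS
  · simpa [singleLayer, h] using isPiece_empty

variable {v : (Fin m → Set ℝ) → ℝ}

theorem IsAdditive.map_empty (hv : IsAdditive v) : v (fun _ => ∅) = 0 := by
  have := hv (fun _ => ∅) (fun _ => ∅) (fun _ => isPiece_empty) (fun _ => isPiece_empty) (by simp)
  simpa using this

theorem IsAdditive.eq_sum (hv : IsAdditive v) {L : Fin m → Set ℝ} (hL : IsLayeredPiece L) :
    v L = ∑ ℓ, v (singleLayer ℓ (L ℓ)) := by
  classical
  have key : ∀ s : Finset (Fin m), v (fun ℓ => if ℓ ∈ s then L ℓ else ∅) =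
      ∑ ℓ ∈ s, v (singleLayer ℓ (L ℓ)) := by
    intro s
    induction s using Finset.induction_on with
    | empty => simpa using hv.map_empty
    | insert a s ha ih =>
      rw [Finset.sum_insert ha, ← ih, ← hv _ _ (isLayeredPiece_singleLayer a (hL a))]
      · congr 1
        funext ℓ
        by_cases h : ℓ = a
        · subst h
          simp [singleLayer, ha]
        · simp [singleLayer, h]
      · intro ℓ
        beta_reduce
        split_ifs
        exacts [hL ℓ, isPiece_empty]
      · intro ℓ
        by_cases h : ℓ = a
        · subst h
          simp [ha]
        · simp [singleLayer, h]
  simpa using key Finset.univ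

theorem Separated.Ioo_inter {a b a' b' : ℝ} (h : Separated a b a' b') :
    Set.Ioo a b ∩ Set.Ioo a' b' = ∅ := by
  ext t
  simp only [Set.mem_inter_iff, Set.mem_Ioo, Set.mem_empty_iff_false, iff_false]
  rcases h with h | h <;> rintro ⟨⟨h1, h2⟩, h3, h4⟩ <;> linarith

theorem Separated.finite_Icc_inter {a b a' b' : ℝ} (h : Separated a b a' b') :
    (Set.Icc a b ∩ Set.Icc a' b').Finite := by
  rcases h with h | h
  · refine (Set.finite_singleton b).subset ?_
    rintro t ⟨⟨_, h2⟩, h3, _⟩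
    exact le_antisymm h2 (h.trans h3)
  · refine (Set.finite_singleton b').subset ?_
    rintro t ⟨⟨h1, _⟩, _, h4⟩
    exact le_antisymm h4 (h.trans h1)

theorem IsAdditive.singleLayer_Icc (hv : IsAdditive v) (ℓ : Fin m) {a b : ℝ} (ha : 0 ≤ a)
    (hab : a ≤ b) (hb : b ≤ 1) : v (singleLayer ℓ (Set.Icc a b)) =
      v (singleLayer ℓ (Set.Icc 0 b)) - v (singleLayer ℓ (Set.Icc 0 a)) := by
  rw [eq_sub_iff_add_eq', ← hv _ _ (isLayeredPiece_singleLayer ℓ (isPiece_Icc le_rfl (hab.trans hb)))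
    (isLayeredPiece_singleLayer ℓ (isPiece_Icc ha hb))]
  · congr 1
    funext ℓ'
    by_cases h : ℓ' = ℓ
    · subst h
      simp [singleLayer, Set.Icc_union_Icc_eq_Icc ha hab]
    · simp [singleLayer, h]
  · intro ℓ'
    by_cases h : ℓ' = ℓ
    · subst h
      simpa [singleLayer, interior_Icc] using Separated.Ioo_inter (a := 0) (b' := b) (Or.inl le_rfl)
    · simp [singleLayer, h]

theorem layeredDist_singleLayer_le (ℓ : Fin m) (a b : ℝ) :
    layeredDist (singleLayer ℓ (Set.Icc 0 a)) (singleLayer ℓ (Set.Icc 0 b)) ≤ |a - b| := by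
  rw [layeredDist, Finset.sum_eq_single ℓ (fun ℓ' _ h => by simp [singleLayer, h]) (by simp)]
  have hsub : symmDiff (Set.Icc 0 a) (Set.Icc 0 b) ⊆ Set.uIcc b a := by
    intro t ht
    rw [Set.mem_uIcc]
    rcases ht with ⟨⟨h1, h2⟩, h3⟩ | ⟨⟨h1, h2⟩, h3⟩
    · exact Or.inl ⟨(not_le.1 fun h => h3 ⟨h1, h⟩).le, h2⟩
    · exact Or.inr ⟨(not_le.1 fun h => h3 ⟨h1, h⟩).le, h2⟩
  simp only [singleLayer, Function.update_self]
  refine ENNReal.toReal_le_of_le_ofReal (abs_nonneg _) ((measure_mono hsub).trans ?_)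
  rw [Real.volume_interval]

/-- The value of the part of a layer to the left of `t`. -/
noncomputable def cumulative (v : (Fin m → Set ℝ) → ℝ) (ℓ : Fin m) (t : ℝ) : ℝ :=
  v (singleLayer ℓ (Set.Icc 0 (clamp 0 1 t)))

theorem continuous_cumulative
    (hcont : ∀ (L : ℕ → Fin m → Set ℝ) (L' : Fin m → Set ℝ),
      (∀ t, IsLayeredPiece (L t)) → IsLayeredPiece L' →
      Filter.Tendsto (fun t => layeredDist (L t) L') Filter.atTop (nhds 0) →
      Filter.Tendsto (fun t => v (L t)) Filter.atTop (nhds (v L'))) (ℓ : Fin m) :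
    Continuous (cumulative v ℓ) := by
  refine continuous_iff_seqContinuous.2 fun u t hu => ?_
  have hp : ∀ t, IsLayeredPiece (singleLayer ℓ (Set.Icc 0 (clamp 0 1 t))) := fun t =>
    isLayeredPiece_singleLayer ℓ (isPiece_Icc le_rfl (clamp_le zero_le_one t))
  refine hcont _ _ (fun N => hp (u N)) (hp t) ?_
  have h1 := (((continuous_clamp 0 1).tendsto t).comp hu).sub_const (clamp 0 1 t)
  rw [sub_self] at h1
  have h2 := h1.abs
  rw [abs_zero] at h2
  exact squeeze_zero (fun N => Finset.sum_nonneg fun _ _ => ENNReal.toReal_nonneg)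
    (fun N => layeredDist_singleLayer_le ℓ _ _) h2

/-- The cumulative values, extended by worthless layers. -/
noncomputable def extendedCumulative (v : (Fin m → Set ℝ) → ℝ) {q : ℕ} (l : Fin q) (t : ℝ) : ℝ :=
  if h : (l : ℕ) < m then cumulative v ⟨l, h⟩ t else 0

theorem continuous_extendedCumulative {q : ℕ} (hc : ∀ ℓ, Continuous (cumulative v ℓ)) (l : Fin q) :
    Continuous (extendedCumulative v l) := by
  unfold extendedCumulative
  split_ifs with h
  · exact hc ⟨l, h⟩
  · exact continuous_const

theorem IsAdditive.eq_sum_extendedCumulative (hv : IsAdditive v) {q : ℕ} (hmq : m ≤ q)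
    {lo hi : Fin q → ℝ} (h0 : ∀ l, 0 ≤ lo l) (hle : ∀ l, lo l ≤ hi l) (h1 : ∀ l, hi l ≤ 1) :
    v (fun ℓ => Set.Icc (lo (Fin.castLE hmq ℓ)) (hi (Fin.castLE hmq ℓ))) =
      ∑ l, (extendedCumulative v l (hi l) - extendedCumulative v l (lo l)) := by
  rw [hv.eq_sum fun ℓ => isPiece_Icc (h0 _) (h1 _)]
  refine Fintype.sum_of_injective (Fin.castLE hmq) (Fin.castLE_injective hmq) _ _
    (fun l hl => ?_) fun ℓ => ?_
  · have : ¬ (l : ℕ) < m := fun h => hl ⟨⟨l, h⟩, rfl⟩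
    simp [extendedCumulative, this]
  · simp only [extendedCumulative, Fin.val_castLE, Fin.is_lt, dif_pos, cumulative]
    rw [hv.singleLayer_Icc ℓ (h0 _) (hle _) (h1 _),
      clamp_of_mem ((h0 _).trans (hle _)) (h1 _), clamp_of_mem (h0 _) ((hle _).trans (h1 _))]

theorem eq_floor_or_eq_ceil {n q c : ℕ} (hq : 0 < q) (h1 : n < q * (c + 1)) (h2 : q * c < n + q) :
    (c : ℤ) = ⌊(n : ℚ) / (q : ℚ)⌋ ∨ (c : ℤ) = ⌈(n : ℚ) / (q : ℚ)⌉ := by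
  have hq' : (0 : ℚ) < q := by exact_mod_cast hq
  rcases le_total (q * c) n with h | h
  · left
    rw [eq_comm, Int.floor_eq_iff, le_div_iff₀ hq', div_lt_iff₀ hq', mul_comm, mul_comm _ (q : ℚ)]
    exact ⟨by exact_mod_cast h, by exact_mod_cast h1⟩
  · right
    rw [eq_comm, Int.ceil_eq_iff, lt_div_iff₀ hq', div_le_iff₀ hq', sub_mul, one_mul, mul_comm,
      sub_lt_iff_lt_add]
    exact ⟨by exact_mod_cast h2, by exact_mod_cast h⟩

end Valuations

/-- Theorem: proportional multi-division. Let `1 ≤ m ≤ q ≤ n` (with `q` not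
necessarily a prime power) and let the `n` agents have additive valuations that are continuous
with respect to the symmetric-difference pseudo-metric. Then there exist a feasible and
contiguous multi-division `A` into `q` layered pieces and a surjective assignment
`π : [n] → [q]` such that every agent receives a layered piece worth at least her proportional
fair share `(1/q)·v_i(C)`, and every piece is assigned `⌊n/q⌋` or `⌈n/q⌉` agents. -/
theorem stmt14 (m n q : ℕ) (hq0 : 0 < q) (hmq : m ≤ q) (hqn : q ≤ n)
    (v : Fin n → (Fin m → Set ℝ) → ℝ)
    (hadd : ∀ i, IsAdditive (v i))
    (hcont : ∀ i (L : ℕ → Fin m → Set ℝ) (L' : Fin m → Set ℝ),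
      (∀ t, IsLayeredPiece (L t)) → IsLayeredPiece L' →
      Filter.Tendsto (fun t => layeredDist (L t) L') Filter.atTop (nhds 0) →
      Filter.Tendsto (fun t => v i (L t)) Filter.atTop (nhds (v i L'))) :
    ∃ A : Fin q → Fin m → Set ℝ,
      IsMultiDivision A ∧ (∀ j, IsContiguous (A j)) ∧ (∀ j, IsNonOverlapping (A j)) ∧
      ∃ π : Fin n → Fin q, Function.Surjective π ∧
        (∀ i : Fin n, (1 / (q : ℝ)) * v i (fun _ => Set.Icc (0 : ℝ) 1) ≤ v i (A (π i))) ∧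
        (∀ j : Fin q,
          ((Finset.univ.filter fun i => π i = j).card : ℤ) = ⌊(n : ℚ) / (q : ℚ)⌋ ∨
          ((Finset.univ.filter fun i => π i = j).card : ℤ) = ⌈(n : ℚ) / (q : ℚ)⌉) := by
  obtain ⟨lo, hi, hd, π, hπ, hle⟩ := divisible_fin hq0 (Fin n)
    (fun i l => extendedCumulative (v i) l) fun i =>
      continuous_extendedCumulative (continuous_cumulative (hcont i))
  have hcard : ∀ j, (Finset.univ.filter fun i => π i = j).card = Nat.card {i // π i = j} := by
    intro j
    rw [Nat.card_eq_fintype_card, Fintype.card_subtype]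
  simp only [IsBalanced, Fintype.card_fin] at hπ hle
  refine ⟨fun j ℓ => Set.Icc (lo j (Fin.castLE hmq ℓ)) (hi j (Fin.castLE hmq ℓ)),
    ⟨fun j ℓ => isPiece_Icc (hd.nonneg _ _) (hd.le_one _ _), fun ℓ => ?_, fun j j' hne ℓ => ?_⟩,
    fun j ℓ => ⟨_, _, rfl⟩, fun j ℓ ℓ' hne => ?_, π, fun j => ?_, fun i => ?_, fun j => ?_⟩
  · refine Set.Subset.antisymm (Set.iUnion_subset fun j =>
      Set.Icc_subset_Icc (hd.nonneg _ _) (hd.le_one _ _)) fun t ht => ?_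
    obtain ⟨j, hj⟩ := hd.cover (Fin.castLE hmq ℓ) t ht
    exact Set.mem_iUnion.2 ⟨j, hj⟩
  · rw [interior_Icc, interior_Icc]
    exact (hd.disjoint _ j j' hne).Ioo_inter
  · exact (hd.feasible j _ _ ((Fin.castLE_injective hmq).ne hne)).finite_Icc_inter
  · have h1 := (hπ j).1
    have h2 : Nat.card {i // π i = j} ≠ 0 := by
      intro h
      rw [h] at h1
      omega
    obtain ⟨⟨i, hi⟩⟩ := (Nat.card_ne_zero.1 h2).1
    exact ⟨i, hi⟩
  · rw [(hadd i).eq_sum_extendedCumulative hmq (lo := fun _ => 0) (hi := fun _ => 1)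
      (fun _ => le_rfl) (fun _ => zero_le_one) fun _ => le_rfl,
      (hadd i).eq_sum_extendedCumulative hmq (hd.nonneg _) (hd.le _) (hd.le_one _)]
    exact hle i
  · rw [hcard]
    exact eq_floor_or_eq_ceil hq0 (hπ j).1 (hπ j).2
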